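/- arXiv:2201.11100 — 4 statements merged into one kernel-verified Lean document; each statement's English description precedes it below -/
import Mathlib

section
/- (Isoperimetric inequality for Schrödinger operators, Euclidean case.) Let n ≥ 2, let Ω ⊂ ℝⁿ be a bounded open set with smooth boundary, x₀ ∈ ℝⁿ, and let R > 0 be such that the ball B(x₀,R) has the same Lebesgue measure as Ω. Let V : (0,∞) → ℝ be continuously differentiable with V ≥ 0 and V' ≤ 0 on (0,∞), and (n−1)V'(r) + 2rV(r)² ≤ 0 for all r ∈ (0,R). For a bounded open set D ⊂ ℝⁿ define λ₁(D) as the infimum of (∫_D (|∇f|² + V(|x−x₀|)f²) dx)/(∫_D f² dx) over all f ∈ C^∞(ℝⁿ, ℝ) vanishing on a neighborhood of x₀ with ∫_D f² dx > 0. Assume there exists u : (0,R] → ℝ, twice continuously differentiable, with u ≥ 0 and u' ≥ 0 on (0,R), u'(R) = 0, r^{n−1}u(r)u'(r) → 0 as r → 0⁺, satisfying u''(r) + ((n−1)/r) u'(r) + (λ_B − V(r)) u(r) = 0 on (0,R), where λ_B = λ₁(B(x₀,R)). Then λ₁(Ω) ≤ λ₁(B(x₀,R)). -/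
open MeasureTheory Set

noncomputable def gradSqR {n : ℕ} (f : EuclideanSpace ℝ (Fin n) → ℝ)
    (x : EuclideanSpace ℝ (Fin n)) : ℝ :=
  ∑ i : Fin n, (fderiv ℝ f x (EuclideanSpace.single i 1)) ^ 2

def HasSmoothBoundary {E : Type*} [NormedAddCommGroup E] [NormedSpace ℝ E] (Ω : Set E) : Prop :=
  ∀ x ∈ frontier Ω, ∃ (f : E → ℝ) (ε : ℝ), 0 < ε ∧ ContDiff ℝ (⊤ : ℕ∞) f ∧
    fderiv ℝ f x ≠ 0 ∧ ∀ y ∈ Metric.ball x ε, (y ∈ Ω ↔ f y < 0)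

/-- The variational first Neumann eigenvalue of the Schrödinger operator Δ + V(|x−x₀|)
on a bounded open set D ⊂ ℝⁿ. -/
noncomputable def lam1Schrodinger {n : ℕ} (x₀ : EuclideanSpace ℝ (Fin n)) (V : ℝ → ℝ)
    (D : Set (EuclideanSpace ℝ (Fin n))) : ℝ :=
  sInf {q | ∃ f : EuclideanSpace ℝ (Fin n) → ℝ, ContDiff ℝ (⊤ : ℕ∞) f ∧
    (∃ ε > 0, ∀ x ∈ Metric.ball x₀ ε, f x = 0) ∧
    0 < ∫ x in D, (f x) ^ 2 ∧
    q = (∫ x in D, gradSqR f x + V ‖x - x₀‖ * (f x) ^ 2) / ∫ x in D, (f x) ^ 2}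

/-- Global solvability of a scalar ODE with bounded, globally Lipschitz right-hand side. -/
theorem exists_hasDerivWithinAt_of_bounded_lipschitz {f : ℝ → ℝ → ℝ} {A B R L K : ℝ}
    (hR : R ∈ Icc A B) (hlip : ∀ t ∈ Icc A B, ∀ x y, |f t x - f t y| ≤ K * |x - y|)
    (hcont : ∀ x, ContinuousOn (fun t => f t x) (Icc A B))
    (hbound : ∀ t ∈ Icc A B, ∀ x, |f t x| ≤ L) (y : ℝ) :
    ∃ α : ℝ → ℝ, α R = y ∧ ∀ t ∈ Icc A B, HasDerivWithinAt α (f t (α t)) (Icc A B) t := by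
  have hm : 0 ≤ max (B - R) (R - A) := le_max_of_le_left (sub_nonneg.2 hR.2)
  have hpl : IsPicardLindelof f (⟨R, hR⟩ : Icc A B) y
      (L.toNNReal * (max (B - R) (R - A)).toNNReal) 0 L.toNNReal K.toNNReal :=
    { lipschitzOnWith := fun t ht => LipschitzOnWith.of_dist_le_mul fun x _ y _ => by
        rw [Real.dist_eq, Real.dist_eq]
        exact (hlip t ht x y).trans
          (mul_le_mul_of_nonneg_right (Real.le_coe_toNNReal K) (abs_nonneg _))
      continuousOn := fun x _ => hcont x
      norm_le := fun t ht x _ => (hbound t ht x).trans (Real.le_coe_toNNReal L)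
      mul_max_le := by simp [Real.coe_toNNReal _ hm] }
  exact hpl.exists_eq_forall_mem_Icc_hasDerivWithinAt₀

/-- The solution of a linear Hamiltonian system `u' = bP`, `P' = cu` with `u(R) = 1`, `P(R) = 0`,
constructed in Prüfer coordinates. -/
theorem exists_linear_system {b c : ℝ → ℝ} {A B R : ℝ} (hR : R ∈ Ioo A B)
    (hb : ContinuousOn b (Icc A B)) (hc : ContinuousOn c (Icc A B)) :
    ∃ u P : ℝ → ℝ, u R = 1 ∧ P R = 0 ∧ ∀ t ∈ Ioo A B,
      HasDerivAt u (b t * P t) t ∧ HasDerivAt P (c t * u t) t ∧ (u t = 0 → P t ≠ 0) := by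
  have hR' := Ioo_subset_Icc_self hR
  obtain ⟨Mb, hMb⟩ := isCompact_Icc.exists_bound_of_continuousOn hb
  obtain ⟨Mc, hMc⟩ := isCompact_Icc.exists_bound_of_continuousOn hc
  have hMb0 : 0 ≤ Mb := (norm_nonneg _).trans (hMb R hR')
  have hMc0 : 0 ≤ Mc := (norm_nonneg _).trans (hMc R hR')
  simp only [Real.norm_eq_abs] at hMb hMc
  have hder : ∀ t x, HasDerivAt (fun x => c t * Real.cos x ^ 2 - b t * Real.sin x ^ 2)
      (-2 * (c t + b t) * (Real.sin x * Real.cos x)) x := fun t x => by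
    refine ((((Real.hasDerivAt_cos x).pow 2).const_mul (c t)).sub
      (((Real.hasDerivAt_sin x).pow 2).const_mul (b t))).congr_deriv ?_
    push_cast; ring
  have hsc : ∀ x : ℝ, |Real.sin x * Real.cos x| ≤ 1 := fun x => by
    rw [abs_mul]
    exact mul_le_one₀ (Real.abs_sin_le_one x) (abs_nonneg _) (Real.abs_cos_le_one x)
  have hadd : ∀ t ∈ Icc A B, |b t + c t| ≤ Mb + Mc := fun t ht =>
    (abs_add_le _ _).trans (add_le_add (hMb t ht) (hMc t ht))
  obtain ⟨ψ, hψR, hψ⟩ := exists_hasDerivWithinAt_of_bounded_lipschitz hR'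
    (f := fun t x => c t * Real.cos x ^ 2 - b t * Real.sin x ^ 2)
    (L := Mb + Mc) (K := 2 * (Mb + Mc))
    (fun t ht x y => by
      refine convex_univ.norm_image_sub_le_of_norm_hasDerivWithin_le
        (f := fun x => c t * Real.cos x ^ 2 - b t * Real.sin x ^ 2)
        (fun x _ => (hder t x).hasDerivWithinAt) (fun x _ => ?_) (mem_univ y) (mem_univ x)
      rw [Real.norm_eq_abs, abs_mul, abs_mul, abs_neg, abs_two, add_comm (c t)]
      nlinarith [hadd t ht, hsc x, abs_nonneg (b t + c t),
        abs_nonneg (Real.sin x * Real.cos x)])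
    (fun x => by fun_prop)
    (fun t ht x => by
      have h1 := hMb t ht
      have h2 := hMc t ht
      have h3 := Real.sin_sq_add_cos_sq x
      rw [abs_le] at h1 h2 ⊢
      constructor <;> nlinarith [sq_nonneg (Real.sin x), sq_nonneg (Real.cos x)]) 0
  have hψc : ContinuousOn ψ (Icc A B) := fun t ht => (hψ t ht).continuousWithinAt
  obtain ⟨χ, hχR, hχ⟩ := exists_hasDerivWithinAt_of_bounded_lipschitz hR'
    (f := fun t _ => (b t + c t) * (Real.sin (ψ t) * Real.cos (ψ t)))
    (L := Mb + Mc) (K := 0) (fun t ht x y => by simp)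
    (fun x => by fun_prop)
    (fun t ht x => by
      rw [abs_mul]
      nlinarith [hadd t ht, hsc (ψ t), abs_nonneg (b t + c t),
        abs_nonneg (Real.sin (ψ t) * Real.cos (ψ t))]) 0
  refine ⟨fun t => Real.exp (χ t) * Real.cos (ψ t), fun t => Real.exp (χ t) * Real.sin (ψ t),
    by simp [hψR, hχR], by simp [hψR], fun t ht => ?_⟩
  have hn := Icc_mem_nhds ht.1 ht.2
  have h1 := (hψ t (Ioo_subset_Icc_self ht)).hasDerivAt hn
  have h2 := (hχ t (Ioo_subset_Icc_self ht)).hasDerivAt hn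
  have h3 := Real.sin_sq_add_cos_sq (ψ t)
  refine ⟨(h2.exp.mul h1.cos).congr_deriv ?_, (h2.exp.mul h1.sin).congr_deriv ?_, fun h0 h0' => ?_⟩
  · linear_combination b t * Real.sin (ψ t) * Real.exp (χ t) * h3
  · linear_combination c t * Real.cos (ψ t) * Real.exp (χ t) * h3
  · simp only [mul_eq_zero, Real.exp_ne_zero, false_or] at h0 h0'
    simp [h0, h0'] at h3

theorem integral_nonneg_of_positive_solution {V u P f f' : ℝ → ℝ} {μ δ R : ℝ} (m : ℕ)
    (hδ : 0 < δ) (hδR : δ ≤ R) (hV : ContinuousOn V (Icc δ R))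
    (hu : ∀ t ∈ Icc δ R, HasDerivAt u (P t / t ^ m) t)
    (hP : ∀ t ∈ Icc δ R, HasDerivAt P ((V t - μ) * t ^ m * u t) t)
    (hPR : P R = 0) (hpos : ∀ t ∈ Icc δ R, 0 < u t)
    (hf : ∀ t, HasDerivAt f (f' t) t) (hf' : Continuous f') (hfδ : f δ = 0) :
    0 ≤ ∫ t in δ..R, t ^ m * (f' t ^ 2 + (V t - μ) * f t ^ 2) := by
  have hfc : Continuous f := continuous_iff_continuousAt.2 fun t => (hf t).continuousAt
  have hH : ∀ t ∈ Icc δ R, HasDerivAt (fun t => P t / u t * f t ^ 2)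
      ((V t - μ) * t ^ m * f t ^ 2 - P t ^ 2 / (t ^ m * u t ^ 2) * f t ^ 2
        + 2 * (P t / u t) * f t * f' t) t := fun t ht => by
    have h0 : u t ≠ 0 := (hpos t ht).ne'
    have h1 : t ^ m ≠ 0 := (pow_pos (hδ.trans_le ht.1) m).ne'
    refine (((hP t ht).div (hu t ht) h0).mul ((hf t).pow 2)).congr_deriv ?_
    simp only [Pi.pow_apply, Pi.div_apply]
    field_simp
    ring
  have key := intervalIntegral.sub_le_integral_of_hasDeriv_right_of_le
    (φ := fun t => t ^ m * (f' t ^ 2 + (V t - μ) * f t ^ 2)) hδR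
    (fun t ht => (hH t ht).continuousAt.continuousWithinAt)
    (fun t ht => (hH t (Ioo_subset_Icc_self ht)).hasDerivWithinAt)
    (ContinuousOn.integrableOn_Icc (by fun_prop))
    (fun t ht => by
      have ht' := Ioo_subset_Icc_self ht
      have h0 : u t ≠ 0 := (hpos t ht').ne'
      have h1 : 0 < t ^ m := pow_pos (hδ.trans_le ht'.1) m
      have : t ^ m * (f' t ^ 2 + (V t - μ) * f t ^ 2) -
          ((V t - μ) * t ^ m * f t ^ 2 - P t ^ 2 / (t ^ m * u t ^ 2) * f t ^ 2
            + 2 * (P t / u t) * f t * f' t) = t ^ m * (f' t - P t * f t / (t ^ m * u t)) ^ 2 := by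
        field_simp
        ring
      have h2 : 0 ≤ t ^ m * (f' t - P t * f t / (t ^ m * u t)) ^ 2 := by positivity
      linarith)
  simpa [hPR, hfδ] using key

/-- An integral is nonnegative as soon as its radial parts in polar coordinates are. -/
theorem integral_nonneg_of_radial {n : ℕ} (hn : 1 ≤ n) (G : EuclideanSpace ℝ (Fin n) → ℝ)
    (hG : ∀ θ : EuclideanSpace ℝ (Fin n), ‖θ‖ = 1 →
      0 ≤ ∫ r in Ioi (0 : ℝ), r ^ (n - 1) * G (r • θ)) : 0 ≤ ∫ x, G x := by
  have : Nonempty (Fin n) := ⟨⟨0, hn⟩⟩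
  set μ : Measure (EuclideanSpace ℝ (Fin n)) := volume
  have h1 : ∫ x, G x ∂μ = ∫ p, G (p.2.1 • p.1.1) ∂μ.toSphere.prod (.volumeIoiPow (n - 1)) := by
    have h := μ.measurePreserving_homeomorphUnitSphereProd.integral_comp
      (Homeomorph.measurableEmbedding _) (fun p => G (p.2.1 • p.1.1))
    rw [finrank_euclideanSpace_fin] at h
    rw [← h]
    have h2 : ∀ x : ({(0)}ᶜ : Set (EuclideanSpace ℝ (Fin n))),
        G (((homeomorphUnitSphereProd _ x).2 : ℝ) • ((homeomorphUnitSphereProd _ x).1).1)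
          = G x := fun x => by
      have hx : ‖x.1‖ ≠ 0 := norm_ne_zero_iff.2 x.2
      simp [smul_smul, hx]
    simp only [h2]
    rw [integral_subtype_comap (measurableSet_singleton _).compl fun x ↦ G x,
        restrict_compl_singleton]
  rw [h1]
  by_cases hi : Integrable (fun p => G (p.2.1 • p.1.1)) (μ.toSphere.prod (.volumeIoiPow (n - 1)))
  · rw [integral_prod _ hi]
    refine integral_nonneg fun θ => ?_
    have hθ : ‖θ.1‖ = 1 := by simp
    refine (hG θ.1 hθ).trans_eq ?_
    simp only [Measure.volumeIoiPow, ENNReal.ofReal]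
    rw [integral_withDensity_eq_integral_smul,
        integral_subtype_comap measurableSet_Ioi
          fun a ↦ Real.toNNReal (a ^ (n - 1)) • G (a • θ.1),
        setIntegral_congr_fun measurableSet_Ioi fun x hx ↦ ?_]
    · rw [NNReal.smul_def, Real.coe_toNNReal _ (pow_nonneg hx.out.le _), smul_eq_mul]
    · exact (measurable_subtype_coe.pow_const _).real_toNNReal
  · rw [integral_undef hi]

theorem sq_fderiv_le_gradSqR {n : ℕ} (f : EuclideanSpace ℝ (Fin n) → ℝ)
    (x θ : EuclideanSpace ℝ (Fin n)) (hθ : ‖θ‖ = 1) : (fderiv ℝ f x θ) ^ 2 ≤ gradSqR f x := by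
  have h1 : fderiv ℝ f x θ = ∑ i, θ i * fderiv ℝ f x (EuclideanSpace.single i 1) := by
    conv_lhs => rw [← (EuclideanSpace.basisFun (Fin n) ℝ).sum_repr θ]
    simp [map_sum]
  have h2 : ∑ i, θ i ^ 2 = 1 := by
    have := EuclideanSpace.real_norm_sq_eq θ
    rw [hθ] at this
    linarith
  rw [h1, gradSqR]
  simpa [h2] using Finset.sum_mul_sq_le_sq_mul_sq Finset.univ (fun i => θ i)
    (fun i => fderiv ℝ f x (EuclideanSpace.single i 1))

theorem continuous_gradSqR {n : ℕ} {f : EuclideanSpace ℝ (Fin n) → ℝ}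
    (hf : ContDiff ℝ (⊤ : ℕ∞) f) : Continuous (gradSqR f) := by
  have := hf.continuous_fderiv (by simp)
  unfold gradSqR
  fun_prop

theorem continuous_radial_mul_sq {n : ℕ} {x₀ : EuclideanSpace ℝ (Fin n)} {V : ℝ → ℝ}
    (hV : ContinuousOn V (Ioi 0)) {f : EuclideanSpace ℝ (Fin n) → ℝ} (hf : Continuous f)
    {ε : ℝ} (hε : 0 < ε) (h0 : ∀ x ∈ Metric.ball x₀ ε, f x = 0) :
    Continuous fun x => V ‖x - x₀‖ * f x ^ 2 := by
  rw [continuous_iff_continuousAt]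
  intro x
  by_cases hx : x = x₀
  · subst hx
    refine (continuousAt_const (y := (0 : ℝ))).congr ?_
    filter_upwards [Metric.ball_mem_nhds x hε] with y hy
    simp [h0 y hy]
  · have : ContinuousAt V ‖x - x₀‖ :=
      hV.continuousAt (Ioi_mem_nhds (norm_pos_iff.2 (sub_ne_zero.2 hx)))
    have h2 : ContinuousAt (fun x => V ‖x - x₀‖) x :=
      ContinuousAt.comp (f := fun x => ‖x - x₀‖) this (by fun_prop)
    fun_prop

theorem integrableOn_of_continuous_of_isBounded {n : ℕ} {D : Set (EuclideanSpace ℝ (Fin n))}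
    (hD : Bornology.IsBounded D) {g : EuclideanSpace ℝ (Fin n) → ℝ} (hg : Continuous g) :
    IntegrableOn g D :=
  (hg.continuousOn.integrableOn_compact hD.isCompact_closure).mono_set subset_closure

/-- A positive radial solution with Neumann data on the sphere bounds the energy from below. -/
theorem mul_integral_sq_le_energy_ball {n : ℕ} (hn : 1 ≤ n) {x₀ : EuclideanSpace ℝ (Fin n)}
    {V u P : ℝ → ℝ} {μ δ ε R : ℝ} (hδ : 0 < δ) (hδε : δ < ε) (hδR : δ < R)
    (hV : ContinuousOn V (Ioi 0))
    (hu : ∀ t ∈ Icc δ R, HasDerivAt u (P t / t ^ (n - 1)) t)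
    (hP : ∀ t ∈ Icc δ R, HasDerivAt P ((V t - μ) * t ^ (n - 1) * u t) t)
    (hPR : P R = 0) (hpos : ∀ t ∈ Icc δ R, 0 < u t)
    {f : EuclideanSpace ℝ (Fin n) → ℝ} (hf : ContDiff ℝ (⊤ : ℕ∞) f)
    (h0 : ∀ x ∈ Metric.ball x₀ ε, f x = 0) :
    μ * ∫ x in Metric.ball x₀ R, f x ^ 2 ≤
      ∫ x in Metric.ball x₀ R, gradSqR f x + V ‖x - x₀‖ * f x ^ 2 := by
  have hc := hf.continuous
  have hg := continuous_gradSqR hf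
  have hfd := hf.continuous_fderiv (by simp)
  have hVf := continuous_radial_mul_sq hV hc (hδ.trans hδε) h0
  have hsum : Continuous fun x => gradSqR f x + V ‖x - x₀‖ * f x ^ 2 := hg.add hVf
  have hb : Bornology.IsBounded (Metric.ball x₀ R) := Metric.isBounded_ball
  rw [← sub_nonneg, ← integral_const_mul, ← integral_sub
    (integrableOn_of_continuous_of_isBounded hb hsum)
    (integrableOn_of_continuous_of_isBounded hb (by fun_prop)),
    ← integral_indicator measurableSet_ball, ← integral_add_left_eq_self _ x₀]
  refine integral_nonneg_of_radial hn _ fun θ hθ => ?_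
  have hd : ∀ t : ℝ, HasDerivAt (fun t : ℝ => f (x₀ + t • θ)) (fderiv ℝ f (x₀ + t • θ) θ) t :=
    fun t => by
      have h1 : HasDerivAt (fun t : ℝ => x₀ + t • θ) θ t := by
        simpa using ((hasDerivAt_id t).smul_const θ).const_add x₀
      exact ((hf.differentiable (by simp)) _).hasFDerivAt.comp_hasDerivAt t h1
  have hnorm : ∀ t : ℝ, 0 < t → ‖t • θ‖ = t := fun t ht => by
    rw [norm_smul, hθ, mul_one, Real.norm_of_nonneg ht.le]
  have key := integral_nonneg_of_positive_solution (n - 1) hδ hδR.le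
    (hV.mono fun t ht => hδ.trans_le ht.1) hu hP hPR hpos hd (by fun_prop)
    (h0 _ (by simpa [hnorm δ hδ] using hδε))
  have hcomp : Continuous fun t : ℝ => x₀ + t • θ := by fun_prop
  refine key.trans ?_
  rw [intervalIntegral.integral_of_le hδR.le, integral_Ioc_eq_integral_Ioo]
  have heq : ∫ r in Ioi (0 : ℝ), r ^ (n - 1) * (Metric.ball x₀ R).indicator
      (fun x => gradSqR f x + V ‖x - x₀‖ * f x ^ 2 - μ * f x ^ 2) (x₀ + r • θ) =
      ∫ r in Ioo δ R, r ^ (n - 1) *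
        (gradSqR f (x₀ + r • θ) + V ‖x₀ + r • θ - x₀‖ * f (x₀ + r • θ) ^ 2
          - μ * f (x₀ + r • θ) ^ 2) := by
    rw [← integral_indicator measurableSet_Ioi, ← integral_indicator measurableSet_Ioo]
    congr 1
    ext r
    by_cases hr : 0 < r
    · rw [indicator_of_mem (mem_Ioi.2 hr)]
      by_cases h1 : r < R
      · rw [indicator_of_mem (by simpa [hnorm r hr] using h1)]
        by_cases h2 : δ < r
        · rw [indicator_of_mem (mem_Ioo.2 ⟨h2, h1⟩)]
        · have hm : x₀ + r • θ ∈ Metric.ball x₀ ε := by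
            simp only [Metric.mem_ball, dist_self_add_left, hnorm r hr]; linarith
          have hgz : gradSqR f (x₀ + r • θ) = 0 := by
            have : fderiv ℝ f (x₀ + r • θ) = 0 := by
              have he : f =ᶠ[nhds (x₀ + r • θ)] fun _ => (0 : ℝ) := by
                filter_upwards [Metric.isOpen_ball.mem_nhds hm] with y hy using h0 y hy
              rw [he.fderiv_eq]; simp
            simp [gradSqR, this]
          rw [indicator_of_notMem (fun h => h2 h.1), hgz, h0 _ hm]
          simp
      · rw [indicator_of_notMem (by simpa [hnorm r hr] using h1),
          indicator_of_notMem fun h => h1 h.2, mul_zero]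
    · rw [indicator_of_notMem (by simpa using hr), indicator_of_notMem fun h => hr (hδ.trans h.1)]
  rw [heq]
  have hVt : ContinuousOn V (Icc δ R) := hV.mono fun t ht => hδ.trans_le ht.1
  refine setIntegral_mono_on (ContinuousOn.integrableOn_Icc (by fun_prop) |>.mono_set
    Ioo_subset_Icc_self) ?_ measurableSet_Ioo fun t ht => ?_
  · refine IntegrableOn.mono_set (t := Icc δ R) ?_ Ioo_subset_Icc_self
    have := hsum.comp hcomp
    simp only [Function.comp_def] at this
    exact Continuous.integrableOn_Icc (by fun_prop)
  · have ht0 := hδ.trans ht.1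
    have h1 := sq_fderiv_le_gradSqR f (x₀ + t • θ) θ hθ
    rw [add_sub_cancel_left, hnorm t ht0]
    have := pow_pos ht0 (n - 1)
    refine mul_le_mul_of_nonneg_left ?_ this.le
    linarith

theorem energy_nonneg {n : ℕ} {x₀ : EuclideanSpace ℝ (Fin n)} {V : ℝ → ℝ}
    (hV0 : ∀ r ∈ Ioi (0 : ℝ), 0 ≤ V r) (D : Set (EuclideanSpace ℝ (Fin n)))
    {f : EuclideanSpace ℝ (Fin n) → ℝ} {ε : ℝ} (hε : 0 < ε)
    (h0 : ∀ x ∈ Metric.ball x₀ ε, f x = 0) :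
    0 ≤ ∫ x in D, gradSqR f x + V ‖x - x₀‖ * f x ^ 2 := by
  refine integral_nonneg fun x => add_nonneg (Finset.sum_nonneg fun i _ => sq_nonneg _) ?_
  by_cases hx : x = x₀
  · simp [hx, h0 x₀ (Metric.mem_ball_self hε)]
  · exact mul_nonneg (hV0 _ (norm_pos_iff.2 (sub_ne_zero.2 hx))) (sq_nonneg _)

theorem lam1Schrodinger_nonneg {n : ℕ} {x₀ : EuclideanSpace ℝ (Fin n)} {V : ℝ → ℝ}
    (hV0 : ∀ r ∈ Ioi (0 : ℝ), 0 ≤ V r) (D : Set (EuclideanSpace ℝ (Fin n))) :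
    0 ≤ lam1Schrodinger x₀ V D := by
  refine Real.sInf_nonneg ?_
  rintro q ⟨f, -, ⟨ε, hε, h0⟩, hpos, rfl⟩
  exact div_nonneg (energy_nonneg hV0 D hε h0) hpos.le

theorem lam1Schrodinger_mul_le {n : ℕ} {x₀ : EuclideanSpace ℝ (Fin n)} {V : ℝ → ℝ}
    (hV0 : ∀ r ∈ Ioi (0 : ℝ), 0 ≤ V r) (D : Set (EuclideanSpace ℝ (Fin n)))
    {f : EuclideanSpace ℝ (Fin n) → ℝ} (hf : ContDiff ℝ (⊤ : ℕ∞) f) {ε : ℝ} (hε : 0 < ε)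
    (h0 : ∀ x ∈ Metric.ball x₀ ε, f x = 0) :
    lam1Schrodinger x₀ V D * ∫ x in D, f x ^ 2 ≤
      ∫ x in D, gradSqR f x + V ‖x - x₀‖ * f x ^ 2 := by
  have hn : 0 ≤ ∫ x in D, f x ^ 2 := integral_nonneg fun x => sq_nonneg _
  rcases hn.eq_or_lt with h | h
  · rw [← h, mul_zero]
    exact energy_nonneg hV0 D hε h0
  · rw [← le_div_iff₀ h]
    refine csInf_le ⟨0, ?_⟩ ⟨f, hf, ⟨ε, hε, h0⟩, h, rfl⟩
    rintro q ⟨g, -, ⟨η, hη, hg0⟩, hpos, rfl⟩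
    exact div_nonneg (energy_nonneg hV0 D hη hg0) hpos.le

theorem gradSqR_radial {n : ℕ} {x₀ : EuclideanSpace ℝ (Fin n)} {φ φ' : ℝ → ℝ}
    (hφ : ∀ r, HasDerivAt φ (φ' r) r) {r₀ : ℝ} (hr₀ : 0 < r₀) (h0 : ∀ r ≤ r₀, φ r = 0)
    (x : EuclideanSpace ℝ (Fin n)) :
    gradSqR (fun x => φ ‖x - x₀‖) x = φ' ‖x - x₀‖ ^ 2 := by
  by_cases hx : x = x₀
  · subst hx
    have h1 : (fun y => φ ‖y - x‖) =ᶠ[nhds x] fun _ => (0 : ℝ) := by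
      filter_upwards [Metric.ball_mem_nhds x hr₀] with y hy
      exact h0 _ (by rw [← dist_eq_norm]; exact (Metric.mem_ball.1 hy).le)
    have h2 : φ' 0 = 0 := by
      have : φ =ᶠ[nhds 0] fun _ => (0 : ℝ) := by
        filter_upwards [Iio_mem_nhds hr₀] with r hr using h0 r (le_of_lt hr)
      rw [← (hφ 0).deriv, this.deriv_eq]; simp
    simp [gradSqR, h1.fderiv_eq, h2]
  · have hne : x - x₀ ≠ 0 := sub_ne_zero.2 hx
    have hnorm : ‖x - x₀‖ ≠ 0 := norm_ne_zero_iff.2 hne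
    have hN : HasFDerivAt (fun x => ‖x - x₀‖) (‖x - x₀‖⁻¹ • innerSL ℝ (x - x₀)) x := by
      have h1 : HasFDerivAt (fun x => ‖x - x₀‖ ^ 2) (2 • (innerSL ℝ (x - x₀))) x := by
        simpa using ((hasFDerivAt_id x).sub_const x₀).norm_sq
      have h2 := h1.sqrt (by positivity)
      simp only [Real.sqrt_sq (norm_nonneg _)] at h2
      refine h2.congr_fderiv ?_
      rw [two_nsmul, ← two_smul ℝ, smul_smul]
      congr 1
      field_simp
    have h3 := (hφ ‖x - x₀‖).comp_hasFDerivAt x hN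
    have h4 : fderiv ℝ (fun x => φ ‖x - x₀‖) x = _ := h3.fderiv
    have h5 : ∑ i, (x - x₀) i ^ 2 = ‖x - x₀‖ ^ 2 := (EuclideanSpace.real_norm_sq_eq _).symm
    rw [gradSqR, h4]
    have h6 : ∀ i : Fin n, ((φ' ‖x - x₀‖ • ‖x - x₀‖⁻¹ • innerSL ℝ (x - x₀))
        (EuclideanSpace.single i 1)) ^ 2
          = φ' ‖x - x₀‖ ^ 2 * (‖x - x₀‖ ^ 2)⁻¹ * (x - x₀) i ^ 2 := fun i => by
      simp [EuclideanSpace.inner_single_right]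
      ring
    simp only [h6]
    rw [← Finset.mul_sum, h5]
    field_simp

theorem contDiff_radial {n : ℕ} {x₀ : EuclideanSpace ℝ (Fin n)} {φ : ℝ → ℝ}
    (hφ : ContDiff ℝ (⊤ : ℕ∞) φ) {r₀ : ℝ} (hr₀ : 0 < r₀) (h0 : ∀ r ≤ r₀, φ r = 0) :
    ContDiff ℝ (⊤ : ℕ∞) fun x : EuclideanSpace ℝ (Fin n) => φ ‖x - x₀‖ := by
  rw [contDiff_iff_contDiffAt]
  intro x
  by_cases hx : x = x₀
  · subst hx
    have h1 : (fun y => φ ‖y - x‖) =ᶠ[nhds x] fun _ => (0 : ℝ) := by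
      filter_upwards [Metric.ball_mem_nhds x hr₀] with y hy
      exact h0 _ (by rw [← dist_eq_norm]; exact (Metric.mem_ball.1 hy).le)
    exact contDiffAt_const.congr_of_eventuallyEq h1
  · have := (contDiffAt_id.sub contDiffAt_const).norm ℝ (n := (⊤ : ℕ∞)) (x := x)
      (f := fun x => x - x₀) (sub_ne_zero.2 hx)
    exact hφ.contDiffAt.comp x this

/-- Smooth approximations of `1_{r > r₀} U(r)` that vanish on `(-∞, r₀]`. -/
theorem exists_smooth_approx {U : ℝ → ℝ} (hU : Continuous U) (r₀ M : ℝ) :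
    ∃ h : ℕ → ℝ → ℝ, (∀ k, ContDiff ℝ (⊤ : ℕ∞) (h k)) ∧ (∀ k, ∀ r ≤ r₀, h k r = 0) ∧
      (∃ C, 0 ≤ C ∧ ∀ k, ∀ r ∈ Icc 0 M, |h k r| ≤ C) ∧
      ∀ r ∈ Icc 0 M, Filter.Tendsto (fun k => h k r) Filter.atTop
        (nhds ((Ioi r₀).indicator U r)) := by
  have hp : ∀ k : ℕ, ∃ p : Polynomial ℝ, ∀ x ∈ Icc 0 M, |p.eval x - U x| < 1 / ((k : ℝ) + 1) :=
    fun k => exists_polynomial_near_of_continuousOn 0 M U hU.continuousOn _ (by positivity)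
  choose p hp using hp
  obtain ⟨C, hC⟩ := (isCompact_Icc (a := (0 : ℝ)) (b := M)).exists_bound_of_continuousOn
    hU.continuousOn
  refine ⟨fun k r => Real.smoothTransition (k * (r - r₀)) * (p k).eval r, fun k => ?_,
    fun k r hr => ?_, ⟨|C| + 1, by positivity, fun k r hr => ?_⟩, fun r hr => ?_⟩
  · have h1 : ContDiff ℝ (⊤ : ℕ∞) fun r : ℝ => (k : ℝ) * (r - r₀) := by fun_prop
    have h2 : ContDiff ℝ (⊤ : ℕ∞) fun r : ℝ => (p k).eval r := by
      simpa using (p k).contDiff_aeval (𝕜 := ℝ) (⊤ : ℕ∞)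
    exact (Real.smoothTransition.contDiff.comp h1).mul h2
  · simp only
    rw [Real.smoothTransition.zero_of_nonpos, zero_mul]
    exact mul_nonpos_of_nonneg_of_nonpos k.cast_nonneg (by linarith)
  · have h1 := hp k r hr
    have h2 := hC r hr
    have h3 : 1 / ((k : ℝ) + 1) ≤ 1 := by
      rw [div_le_one (by positivity)]
      linarith [k.cast_nonneg (α := ℝ)]
    have h4 := Real.smoothTransition.nonneg (k * (r - r₀))
    have h5 := Real.smoothTransition.le_one (k * (r - r₀))
    have h6 : |(p k).eval r| ≤ |C| + 1 := by
      have := abs_sub_abs_le_abs_sub ((p k).eval r) (U r)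
      rw [Real.norm_eq_abs] at h2
      linarith [le_abs_self C]
    rw [abs_mul, abs_of_nonneg h4]
    nlinarith [abs_nonneg ((p k).eval r)]
  · by_cases h : r₀ < r
    · rw [indicator_of_mem (mem_Ioi.2 h)]
      have h1 : Filter.Tendsto (fun k => (p k).eval r) Filter.atTop (nhds (U r)) := by
        rw [tendsto_iff_norm_sub_tendsto_zero]
        exact squeeze_zero (fun k => norm_nonneg _) (fun k => (hp k r hr).le)
          tendsto_one_div_add_atTop_nhds_zero_nat
      refine h1.congr' ?_
      have h2 : Filter.Tendsto (fun k : ℕ => (k : ℝ) * (r - r₀)) Filter.atTop Filter.atTop :=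
        tendsto_natCast_atTop_atTop.atTop_mul_const (by linarith)
      filter_upwards [h2.eventually_ge_atTop 1] with k hk
      rw [Real.smoothTransition.one_of_one_le hk, one_mul]
    · rw [indicator_of_notMem (by simpa using h)]
      refine tendsto_const_nhds.congr fun k => ?_
      simp only
      rw [Real.smoothTransition.zero_of_nonpos, zero_mul]
      exact mul_nonpos_of_nonneg_of_nonpos k.cast_nonneg (by linarith [not_lt.1 h])

/-- The variational inequality extends to radial functions vanishing near the center whose
derivative is continuous up to one jump. -/
theorem lam1Schrodinger_mul_le_radial {n : ℕ} {x₀ : EuclideanSpace ℝ (Fin n)} {V : ℝ → ℝ}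
    (hV0 : ∀ r ∈ Ioi (0 : ℝ), 0 ≤ V r) (hV : ContinuousOn V (Ioi 0))
    {D : Set (EuclideanSpace ℝ (Fin n))} (hDm : MeasurableSet D) (hD : Bornology.IsBounded D)
    {U : ℝ → ℝ} (hU : Continuous U) {r₀ : ℝ} (hr₀ : 0 < r₀) {w : ℝ → ℝ}
    (hw : ∀ r, w r = ∫ s in 0..r, (Ioi r₀).indicator U s) :
    lam1Schrodinger x₀ V D * ∫ x in D, w ‖x - x₀‖ ^ 2 ≤
      ∫ x in D, (Ioi r₀).indicator U ‖x - x₀‖ ^ 2 + V ‖x - x₀‖ * w ‖x - x₀‖ ^ 2 := by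
  obtain ⟨M, hM0, hM⟩ := hD.subset_ball_lt 0 x₀
  obtain ⟨h, hsm, hz, ⟨C, hC0, hC⟩, hlim⟩ := exists_smooth_approx hU r₀ M
  have hMr : ∀ x ∈ D, ‖x - x₀‖ ∈ Icc 0 M := fun x hx =>
    ⟨norm_nonneg _, by rw [← dist_eq_norm]; exact (Metric.mem_ball.1 (hM hx)).le⟩
  set φ : ℕ → ℝ → ℝ := fun k r => ∫ s in 0..r, h k s with hφdef
  have hφd : ∀ k r, HasDerivAt (φ k) (h k r) r := fun k r =>
    (hsm k).continuous.integral_hasStrictDerivAt 0 r |>.hasDerivAt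
  have hφs : ∀ k, ContDiff ℝ (⊤ : ℕ∞) (φ k) := fun k => by
    rw [contDiff_infty_iff_deriv]
    refine ⟨fun r => (hφd k r).differentiableAt, ?_⟩
    rw [show deriv (φ k) = h k from funext fun r => (hφd k r).deriv]
    exact hsm k
  have hφz : ∀ k, ∀ r ≤ r₀, φ k r = 0 := fun k r hr => by
    refine intervalIntegral.integral_zero_ae (Filter.Eventually.of_forall fun s hs => hz k s ?_)
    rcases le_total 0 r with h' | h'
    · rw [uIoc_of_le h'] at hs; exact hs.2.trans hr
    · rw [uIoc_of_ge h'] at hs; exact hs.2.trans hr₀.le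
  have hφb : ∀ k, ∀ r ∈ Icc 0 M, |φ k r| ≤ C * M := fun k r hr => by
    have := intervalIntegral.norm_integral_le_of_norm_le_const (a := 0) (b := r) (f := h k)
      (C := C) fun s hs => by
        rw [uIoc_of_le hr.1] at hs
        exact hC k s ⟨hs.1.le, hs.2.trans hr.2⟩
    rw [sub_zero, abs_of_nonneg hr.1] at this
    exact this.trans (mul_le_mul_of_nonneg_left hr.2 hC0)
  have hφlim : ∀ r ∈ Icc 0 M, Filter.Tendsto (fun k => φ k r) Filter.atTop (nhds (w r)) :=
    fun r hr => by
      rw [hw r]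
      refine intervalIntegral.tendsto_integral_filter_of_dominated_convergence (fun _ => C)
        (Filter.Eventually.of_forall fun k => (hsm k).continuous.aestronglyMeasurable)
        (Filter.Eventually.of_forall fun k => Filter.Eventually.of_forall fun s hs => ?_)
        (by simp) (Filter.Eventually.of_forall fun s hs => ?_) <;> rw [uIoc_of_le hr.1] at hs
      · exact hC k s ⟨hs.1.le, hs.2.trans hr.2⟩
      · exact hlim s ⟨hs.1.le, hs.2.trans hr.2⟩
  have hball : ∀ k, ∀ x ∈ Metric.ball x₀ r₀, φ k ‖x - x₀‖ = 0 := fun k x hx =>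
    hφz k _ (by rw [← dist_eq_norm]; exact (Metric.mem_ball.1 hx).le)
  have hFs : ∀ k, ContDiff ℝ (⊤ : ℕ∞) fun x : EuclideanSpace ℝ (Fin n) => φ k ‖x - x₀‖ :=
    fun k => contDiff_radial (hφs k) hr₀ (hφz k)
  have hfin : IsFiniteMeasure (volume.restrict D) :=
    isFiniteMeasure_restrict.2 hD.measure_lt_top.ne
  obtain ⟨K, hK⟩ := (isCompact_Icc (a := r₀) (b := M)).exists_bound_of_continuousOn
    (hV.mono fun t ht => hr₀.trans_le ht.1)
  have hmem := ae_restrict_mem (μ := (volume : Measure (EuclideanSpace ℝ (Fin n)))) hDm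
  have hineq : ∀ k, lam1Schrodinger x₀ V D * ∫ x in D, φ k ‖x - x₀‖ ^ 2 ≤
      ∫ x in D, h k ‖x - x₀‖ ^ 2 + V ‖x - x₀‖ * φ k ‖x - x₀‖ ^ 2 := fun k => by
    have := lam1Schrodinger_mul_le hV0 D (hFs k) hr₀ (hball k)
    simpa only [gradSqR_radial (hφd k) hr₀ (hφz k)] using this
  refine le_of_tendsto_of_tendsto' (b := Filter.atTop) (Filter.Tendsto.const_mul _ ?_) ?_ hineq
  · refine tendsto_integral_of_dominated_convergence (fun _ => (C * M) ^ 2)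
      (fun k => ((hFs k).continuous.pow 2).aestronglyMeasurable) (integrable_const _)
      (fun k => ?_) ?_
    · filter_upwards [hmem] with x hx
      rw [Real.norm_eq_abs, abs_pow]
      exact pow_le_pow_left₀ (abs_nonneg _) (hφb k _ (hMr x hx)) 2
    · filter_upwards [hmem] with x hx using (hφlim _ (hMr x hx)).pow 2
  · refine tendsto_integral_of_dominated_convergence (fun _ => C ^ 2 + |K| * (C * M) ^ 2)
      (fun k => ?_) (integrable_const _) (fun k => ?_) ?_
    · have h1 := continuous_radial_mul_sq hV (hFs k).continuous hr₀ (hball k)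
      have h2 := (hsm k).continuous
      exact Continuous.aestronglyMeasurable (by fun_prop)
    · filter_upwards [hmem] with x hx
      refine (norm_add_le _ _).trans (add_le_add ?_ ?_)
      · rw [Real.norm_eq_abs, abs_pow]
        exact pow_le_pow_left₀ (abs_nonneg _) (hC k _ (hMr x hx)) 2
      · by_cases hr : r₀ ≤ ‖x - x₀‖
        · rw [norm_mul, Real.norm_eq_abs (_ ^ 2), abs_pow]
          exact mul_le_mul ((hK _ ⟨hr, (hMr x hx).2⟩).trans (le_abs_self K))
            (pow_le_pow_left₀ (abs_nonneg _) (hφb k _ (hMr x hx)) 2) (by positivity)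
            (abs_nonneg _)
        · rw [hφz k _ (not_le.1 hr).le]
          simp only [ne_eq, OfNat.ofNat_ne_zero, not_false_eq_true, zero_pow, mul_zero, norm_zero]
          positivity
    · filter_upwards [hmem] with x hx
      exact ((hlim _ (hMr x hx)).pow 2).add (((hφlim _ (hMr x hx)).pow 2).const_mul _)

theorem antitoneOn_of_deriv_nonpos_Ioi {V : ℝ → ℝ}
    (hVd : ∀ r ∈ Ioi (0 : ℝ), DifferentiableAt ℝ V r)
    (hV' : ∀ r ∈ Ioi (0 : ℝ), deriv V r ≤ 0) : AntitoneOn V (Ioi 0) :=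
  antitoneOn_of_deriv_nonpos (convex_Ioi 0)
    (fun r hr => (hVd r hr).continuousAt.continuousWithinAt)
    (fun r hr => (hVd r (interior_subset hr)).differentiableWithinAt)
    (fun r hr => hV' r (interior_subset hr))

/-- If the solution vanishes at `r₀` and is positive on `(r₀, R]`, its flux is nonnegative there
and the potential drops below `μ` before `R`. -/
theorem flux_nonneg_and_le {V u P : ℝ → ℝ} {μ r₀ R : ℝ} (m : ℕ) (hr₀ : 0 < r₀) (hR : r₀ < R)
    (hV : AntitoneOn V (Ioi 0))
    (hu : ∀ t ∈ Icc r₀ R, HasDerivAt u (P t / t ^ m) t)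
    (hP : ∀ t ∈ Icc r₀ R, HasDerivAt P ((V t - μ) * t ^ m * u t) t)
    (hPR : P R = 0) (hu0 : u r₀ = 0) (hpos : ∀ t ∈ Ioc r₀ R, 0 < u t) (hP0 : P r₀ ≠ 0) :
    (∀ t ∈ Icc r₀ R, 0 ≤ P t) ∧ V R ≤ μ := by
  have huc : ContinuousOn u (Icc r₀ R) := fun t ht => (hu t ht).continuousAt.continuousWithinAt
  have hPc : ContinuousOn P (Icc r₀ R) := fun t ht => (hP t ht).continuousAt.continuousWithinAt
  have hmvt : ∀ s t, r₀ ≤ s → s < t → t ≤ R →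
      ∃ ξ ∈ Ioo s t, (V ξ - μ) * ξ ^ m * u ξ = (P t - P s) / (t - s) := fun s t hs hst ht =>
    exists_hasDerivAt_eq_slope P _ hst (hPc.mono (Icc_subset_Icc hs ht))
      fun ξ hξ => hP ξ ⟨hs.trans hξ.1.le, hξ.2.le.trans ht⟩
  have hw : ∀ ξ, r₀ < ξ → ξ ≤ R → 0 < ξ ^ m * u ξ := fun ξ h1 h2 =>
    mul_pos (pow_pos (hr₀.trans h1) m) (hpos ξ ⟨h1, h2⟩)
  have hinc : ∀ s t, r₀ ≤ s → s < t → t ≤ R → P s < P t → ∃ ξ ∈ Ioo s t, μ < V ξ := by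
    intro s t hs hst ht hlt
    obtain ⟨ξ, hξ, he⟩ := hmvt s t hs hst ht
    refine ⟨ξ, hξ, ?_⟩
    have h1 : 0 < (P t - P s) / (t - s) := div_pos (by linarith) (by linarith)
    rw [← he, mul_assoc] at h1
    linarith [pos_of_mul_pos_left h1 (hw ξ (hs.trans_lt hξ.1) (hξ.2.le.trans ht)).le]
  have hdec : ∀ s t, r₀ ≤ s → s < t → t ≤ R → P t < P s → ∃ ξ ∈ Ioo s t, V ξ < μ := by
    intro s t hs hst ht hlt
    obtain ⟨ξ, hξ, he⟩ := hmvt s t hs hst ht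
    refine ⟨ξ, hξ, ?_⟩
    have h1 : (P t - P s) / (t - s) < 0 := div_neg_of_neg_of_pos (by linarith) (by linarith)
    rw [← he, mul_assoc] at h1
    by_contra! h
    exact absurd h1 (not_lt.2 (mul_nonneg (by linarith)
      (hw ξ (hs.trans_lt hξ.1) (hξ.2.le.trans ht)).le))
  have hI : ∀ t ∈ Ioc r₀ R, 0 ≤ P t := by
    intro t ht
    by_contra! hneg
    have htR : t < R := ht.2.lt_of_ne fun h => by rw [h, hPR] at hneg; exact lt_irrefl _ hneg
    obtain ⟨ξ, hξ, hVξ⟩ := hinc t R ht.1.le htR le_rfl (by rwa [hPR])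
    obtain ⟨s, hs, he⟩ := exists_hasDerivAt_eq_slope u _ ht.1
      (huc.mono (Icc_subset_Icc le_rfl ht.2)) fun ξ hξ => hu ξ ⟨hξ.1.le, hξ.2.le.trans ht.2⟩
    have h1 : 0 < P s / s ^ m := by
      rw [he, hu0, sub_zero]
      exact div_pos (hpos t ht) (by linarith [ht.1])
    have hPs : 0 < P s := by
      have hsm := pow_pos (hr₀.trans hs.1) m
      have := mul_pos h1 hsm
      rwa [div_mul_cancel₀ _ hsm.ne'] at this
    obtain ⟨η, hη, hVη⟩ := hdec s t hs.1.le hs.2 ht.2 (hneg.trans hPs)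
    have hη0 : 0 < η := hr₀.trans (hs.1.trans hη.1)
    have := hV (mem_Ioi.2 hη0) (mem_Ioi.2 (hr₀.trans (ht.1.trans hξ.1))) (hη.2.trans hξ.1).le
    linarith
  have hP0' : 0 ≤ P r₀ := by
    have hc : Filter.Tendsto P (nhdsWithin r₀ (Ioi r₀)) (nhds (P r₀)) :=
      (hP r₀ (left_mem_Icc.2 hR.le)).continuousAt.tendsto.mono_left nhdsWithin_le_nhds
    refine ge_of_tendsto hc ?_
    filter_upwards [Ioc_mem_nhdsGT hR] with t ht using hI t ht
  refine ⟨fun t ht => ?_, ?_⟩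
  · rcases ht.1.eq_or_lt with h | h
    · rwa [← h]
    · exact hI t ⟨h, ht.2⟩
  · obtain ⟨ξ, hξ, hVξ⟩ := hdec r₀ R le_rfl hR le_rfl
      (by rw [hPR]; exact hP0'.lt_of_ne' hP0)
    exact (hV (mem_Ioi.2 (hr₀.trans hξ.1)) (mem_Ioi.2 (hr₀.trans hR)) hξ.2.le).trans hVξ.le

/-- The energy density of a nondecreasing solution is nonincreasing. -/
theorem antitoneOn_energy_density {V u P : ℝ → ℝ} {μ r₀ R : ℝ} {m : ℕ} (hm : 1 ≤ m)
    (hr₀ : 0 < r₀) (hμ : 0 ≤ μ)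
    (hVd : ∀ r ∈ Ioi (0 : ℝ), DifferentiableAt ℝ V r)
    (hV' : ∀ r ∈ Ioi (0 : ℝ), deriv V r ≤ 0)
    (hcond : ∀ r ∈ Ioo 0 R, (m : ℝ) * deriv V r + 2 * r * (V r) ^ 2 ≤ 0)
    (hu : ∀ t ∈ Icc r₀ R, HasDerivAt u (P t / t ^ m) t)
    (hP : ∀ t ∈ Icc r₀ R, HasDerivAt P ((V t - μ) * t ^ m * u t) t)
    (hu0 : ∀ t ∈ Icc r₀ R, 0 ≤ u t) (hP0 : ∀ t ∈ Icc r₀ R, 0 ≤ P t) :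
    AntitoneOn (fun t => (P t / t ^ m) ^ 2 + (V t - μ) * u t ^ 2) (Icc r₀ R) := by
  have hd : ∀ t ∈ Icc r₀ R, HasDerivAt (fun t => (P t / t ^ m) ^ 2 + (V t - μ) * u t ^ 2)
      (4 * (V t - μ) * u t * (P t / t ^ m) - 2 * m / t * (P t / t ^ m) ^ 2
        + deriv V t * u t ^ 2) t := fun t ht => by
    have ht0 : 0 < t := hr₀.trans_le ht.1
    have h1 : HasDerivAt (fun t => P t / t ^ m) ((V t - μ) * u t - m / t * (P t / t ^ m)) t := by
      refine ((hP t ht).div (hasDerivAt_pow m t) (pow_pos ht0 m).ne').congr_deriv ?_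
      obtain ⟨k, rfl⟩ : ∃ k, m = k + 1 := ⟨m - 1, by omega⟩
      simp only [Nat.add_sub_cancel]
      field_simp
      ring
    have h2 := ((hVd t ht0).hasDerivAt.sub_const μ).mul ((hu t ht).pow 2)
    refine ((h1.pow 2).add h2).congr_deriv ?_
    simp only [Pi.pow_apply]
    push_cast
    ring
  refine antitoneOn_of_deriv_nonpos (convex_Icc r₀ R)
    (fun t ht => (hd t ht).continuousAt.continuousWithinAt)
    (fun t ht => (hd t (interior_subset ht)).differentiableAt.differentiableWithinAt)
    fun t ht => ?_
  have ht' := interior_subset ht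
  rw [interior_Icc] at ht
  rw [(hd t ht').deriv]
  have ht0 : 0 < t := hr₀.trans_le ht'.1
  have hv : 0 ≤ P t / t ^ m := div_nonneg (hP0 t ht') (pow_pos ht0 m).le
  set v := P t / t ^ m
  have hu' := hu0 t ht'
  have hVt := hV' t ht0
  have hc := hcond t ⟨ht0, ht.2⟩
  have hm0 : 0 < (m : ℝ) := by exact_mod_cast hm
  rcases le_total (V t) μ with h | h
  · have h1 : (V t - μ) * (u t * v) ≤ 0 :=
      mul_nonpos_of_nonpos_of_nonneg (by linarith) (mul_nonneg hu' hv)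
    have h2 : 0 ≤ 2 * m / t * v ^ 2 := by positivity
    have h3 : deriv V t * u t ^ 2 ≤ 0 := mul_nonpos_of_nonpos_of_nonneg hVt (sq_nonneg _)
    linarith
  · have h1 : (V t - μ) * (u t * v) ≤ V t * (u t * v) :=
      mul_le_mul_of_nonneg_right (by linarith) (mul_nonneg hu' hv)
    have h2 : (m * deriv V t + 2 * t * V t ^ 2) * u t ^ 2 ≤ 0 :=
      mul_nonpos_of_nonpos_of_nonneg hc (sq_nonneg _)
    have h3 : m * t * (4 * V t * (u t * v) - 2 * m / t * v ^ 2 - 2 * t * V t ^ 2 / m * u t ^ 2)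
        = -2 * (m * v - t * V t * u t) ^ 2 := by
      field_simp
      ring
    have h4 : 4 * V t * (u t * v) - 2 * m / t * v ^ 2 - 2 * t * V t ^ 2 / m * u t ^ 2 ≤ 0 := by
      by_contra! h
      have := mul_pos (mul_pos hm0 ht0) h
      nlinarith [sq_nonneg (m * v - t * V t * u t)]
    have h5 : deriv V t * u t ^ 2 ≤ - (2 * t * V t ^ 2 / m * u t ^ 2) := by
      have : deriv V t * u t ^ 2 + 2 * t * V t ^ 2 / m * u t ^ 2
        = ((m * deriv V t + 2 * t * V t ^ 2) * u t ^ 2) / m := by field_simp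
      have h6 := div_nonpos_of_nonpos_of_nonneg h2 hm0.le
      linarith
    linarith

theorem integral_radial_sq_pos {n : ℕ} (hn : 1 ≤ n) {x₀ : EuclideanSpace ℝ (Fin n)} {r₀ R : ℝ}
    (hr₀ : 0 ≤ r₀) (hR : r₀ < R) {D : Set (EuclideanSpace ℝ (Fin n))}
    (hD : Bornology.IsBounded D) (hvol : volume (Metric.ball x₀ R) = volume D)
    {w : ℝ → ℝ} (hw : Continuous w) (hpos : ∀ r, r₀ < r → 0 < w r) :
    0 < ∫ x in D, w ‖x - x₀‖ ^ 2 := by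
  have : Nonempty (Fin n) := ⟨⟨0, hn⟩⟩
  have hi : IntegrableOn (fun x => w ‖x - x₀‖ ^ 2) D :=
    integrableOn_of_continuous_of_isBounded hD (by fun_prop)
  rw [setIntegral_pos_iff_support_of_nonneg_ae
    (Filter.Eventually.of_forall fun x => sq_nonneg _) hi, pos_iff_ne_zero]
  intro h0
  have hsub : D ⊆ (Function.support (fun x => w ‖x - x₀‖ ^ 2) ∩ D) ∪ Metric.closedBall x₀ r₀ := by
    intro x hx
    by_cases h : ‖x - x₀‖ ≤ r₀
    · exact Or.inr (by rwa [Metric.mem_closedBall, dist_eq_norm])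
    · exact Or.inl ⟨(pow_pos (hpos _ (not_le.1 h)) 2).ne', hx⟩
  have h1 := (measure_mono (μ := volume) hsub).trans (measure_union_le _ _)
  rw [h0, zero_add, ← hvol, Measure.addHaar_closedBall _ _ hr₀,
    Measure.addHaar_ball _ _ (hr₀.trans hR.le), finrank_euclideanSpace_fin] at h1
  have h2 : volume (Metric.ball (0 : EuclideanSpace ℝ (Fin n)) 1) ≠ 0 :=
    (Metric.measure_ball_pos _ _ one_pos).ne'
  have h3 := (ENNReal.mul_le_mul_iff_left h2 measure_ball_lt_top.ne).1 h1
  rw [ENNReal.ofReal_le_ofReal_iff (by positivity)] at h3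
  exact absurd h3 (not_le.2 (pow_lt_pow_left₀ hR hr₀ (by omega)))

/-- Bathtub principle: a function above level `c` on `B` and below it off `B`. -/
theorem setIntegral_le_of_level {X : Type*} [MeasurableSpace X] {μ : Measure X} {D B : Set X}
    (hD : MeasurableSet D) (hB : MeasurableSet B) (hvol : μ B = μ D) (hfin : μ D ≠ ⊤)
    {g : X → ℝ} {c : ℝ} (hgD : IntegrableOn g D μ) (hgB : IntegrableOn g B μ)
    (hin : ∀ x ∈ B, c ≤ g x) (hout : ∀ x ∉ B, g x ≤ c) :
    ∫ x in D, g x ∂μ ≤ ∫ x in B, g x ∂μ := by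
  have hcD : IntegrableOn (fun _ => c) D μ := integrableOn_const hfin
  have hcB : IntegrableOn (fun _ => c) B μ := integrableOn_const (hvol ▸ hfin)
  have hsD : IntegrableOn (fun x => g x - c) D μ := hgD.sub hcD
  have hsB : IntegrableOn (fun x => g x - c) B μ := hgB.sub hcB
  have h1 : ∫ x in D, (g x - c) ∂μ ≤ ∫ x in B, (g x - c) ∂μ := by
    rw [← integral_inter_add_sdiff hB hsD]
    have h2 : ∫ x in D \ B, (g x - c) ∂μ ≤ 0 :=
      setIntegral_nonpos (hD.diff hB) fun x hx => sub_nonpos.2 (hout x hx.2)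
    have h3 : ∫ x in D ∩ B, (g x - c) ∂μ ≤ ∫ x in B, (g x - c) ∂μ :=
      setIntegral_mono_set hsB
        ((ae_restrict_mem hB).mono fun x hx => sub_nonneg.2 (hin x hx))
        (Filter.Eventually.of_forall inter_subset_right)
    linarith
  rw [integral_sub hgD hcD, integral_sub hgB hcB, setIntegral_const, setIntegral_const,
    measureReal_def, measureReal_def, hvol] at h1
  linarith

theorem lam1Schrodinger_le_of_solution {n : ℕ} (hn : 2 ≤ n) {x₀ : EuclideanSpace ℝ (Fin n)}
    {Ω : Set (EuclideanSpace ℝ (Fin n))} (hΩm : MeasurableSet Ω) (hΩ : Bornology.IsBounded Ω)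
    {V u P : ℝ → ℝ} {μ r₀ R : ℝ} (hr₀ : 0 < r₀) (hR : r₀ < R)
    (hvol : volume (Metric.ball x₀ R) = volume Ω) (hμ : 0 ≤ μ)
    (hVd : ∀ r ∈ Ioi (0 : ℝ), DifferentiableAt ℝ V r)
    (hV0 : ∀ r ∈ Ioi (0 : ℝ), 0 ≤ V r)
    (hV' : ∀ r ∈ Ioi (0 : ℝ), deriv V r ≤ 0)
    (hcond : ∀ r ∈ Ioo 0 R, ((n : ℝ) - 1) * deriv V r + 2 * r * (V r) ^ 2 ≤ 0)
    (hu : ∀ t ∈ Icc r₀ R, HasDerivAt u (P t / t ^ (n - 1)) t)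
    (hP : ∀ t ∈ Icc r₀ R, HasDerivAt P ((V t - μ) * t ^ (n - 1) * u t) t)
    (hPR : P R = 0) (hu0 : u r₀ = 0) (hpos : ∀ t ∈ Ioc r₀ R, 0 < u t) (hP0 : P r₀ ≠ 0) :
    lam1Schrodinger x₀ V Ω ≤ μ := by
  have hVc : ContinuousOn V (Ioi 0) := fun r hr => (hVd r hr).continuousAt.continuousWithinAt
  have hVanti := antitoneOn_of_deriv_nonpos_Ioi hVd hV'
  obtain ⟨hPnn, hVR⟩ := flux_nonneg_and_le (n - 1) hr₀ hR hVanti hu hP hPR hu0 hpos hP0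
  have hunn : ∀ t ∈ Icc r₀ R, 0 ≤ u t := fun t ht => by
    rcases ht.1.eq_or_lt with h | h
    · rw [← h, hu0]
    · exact (hpos t ⟨h, ht.2⟩).le
  have hanti := antitoneOn_energy_density (m := n - 1) (by omega) hr₀ hμ hVd hV'
    (by rwa [Nat.cast_sub (by omega), Nat.cast_one]) hu hP hunn hPnn
  have huc : ContinuousOn u (Icc r₀ R) := fun t ht => (hu t ht).continuousAt.continuousWithinAt
  have hPc : ContinuousOn P (Icc r₀ R) := fun t ht => (hP t ht).continuousAt.continuousWithinAt
  have hvc : ContinuousOn (fun t => P t / t ^ (n - 1)) (Icc r₀ R) :=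
    hPc.div (by fun_prop) fun t ht => (pow_pos (hr₀.trans_le ht.1) _).ne'
  set κ : ℝ → ℝ := fun s => max r₀ (min s R) with hκ
  have hκc : Continuous κ := by fun_prop
  have hκm : ∀ s, κ s ∈ Icc r₀ R := fun s => ⟨le_max_left _ _, max_le hR.le (min_le_right _ _)⟩
  have hκlo : ∀ s ≤ r₀, κ s = r₀ := fun s hs => by
    simp only [hκ]; rw [min_eq_left (hs.trans hR.le), max_eq_left hs]
  have hκmid : ∀ s ∈ Icc r₀ R, κ s = s := fun s hs => by
    simp only [hκ]; rw [min_eq_left hs.2, max_eq_right hs.1]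
  have hκhi : ∀ s, R ≤ s → κ s = R := fun s hs => by
    simp only [hκ]; rw [min_eq_right hs, max_eq_right hR.le]
  set U : ℝ → ℝ := fun s => P (κ s) / κ s ^ (n - 1) with hUdef
  have hU : Continuous U := hvc.comp_continuous hκc hκm
  set w : ℝ → ℝ := fun s => u (κ s) with hwdef
  have hwc : Continuous w := huc.comp_continuous hκc hκm
  have hwlo : ∀ s ≤ r₀, w s = 0 := fun s hs => by simp only [hwdef, hκlo s hs, hu0]
  have hUhi : ∀ s, R ≤ s → U s = 0 := fun s hs => by simp [hUdef, hκhi s hs, hPR]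
  have hwd : ∀ s, s ≠ r₀ → s ≠ R → HasDerivAt w ((Ioi r₀).indicator U s) s := by
    intro s h1 h2
    rcases lt_or_gt_of_ne h1 with h | h
    · rw [indicator_of_notMem (by simpa using h.le)]
      refine (hasDerivAt_const s (0 : ℝ)).congr_of_eventuallyEq ?_
      filter_upwards [Iio_mem_nhds h] with t ht using hwlo t ht.le
    · rw [indicator_of_mem (mem_Ioi.2 h)]
      rcases lt_or_gt_of_ne h2 with h' | h'
      · have hs : s ∈ Icc r₀ R := ⟨h.le, h'.le⟩
        have h3 := hu s hs
        simp only [hUdef, hκmid s hs]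
        refine h3.congr_of_eventuallyEq ?_
        filter_upwards [Ioo_mem_nhds h h'] with t ht
        simp only [hwdef, hκmid t (Ioo_subset_Icc_self ht)]
      · rw [hUhi s h'.le]
        refine (hasDerivAt_const s (u R)).congr_of_eventuallyEq ?_
        filter_upwards [Ioi_mem_nhds h'] with t ht
        simp only [hwdef, hκhi t (le_of_lt ht)]
  have hw : ∀ r, w r = ∫ s in 0..r, (Ioi r₀).indicator U s := fun r => by
    have hint : IntervalIntegrable ((Ioi r₀).indicator U) volume 0 r :=
      ⟨(hU.intervalIntegrable 0 r).1.indicator measurableSet_Ioi,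
        (hU.intervalIntegrable 0 r).2.indicator measurableSet_Ioi⟩
    rw [MeasureTheory.integral_eq_of_hasDerivAt_off_countable w _
      ((countable_singleton R).insert r₀) hwc.continuousOn (fun x hx => hwd x
        (fun h => hx.2 (by simp [h])) (fun h => hx.2 (by simp [h]))) hint, hwlo 0 hr₀.le, sub_zero]
  have hmain := lam1Schrodinger_mul_le_radial (x₀ := x₀) hV0 hVc hΩm hΩ hU hr₀ hw
  have hwpos : 0 < ∫ x in Ω, w ‖x - x₀‖ ^ 2 :=
    integral_radial_sq_pos (by omega) hr₀.le hR hΩ hvol hwc fun r hr => by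
      refine hpos _ ⟨?_, (hκm r).2⟩
      exact lt_max_of_lt_right (lt_min hr hR)
  set G : ℝ → ℝ := fun r => (Ioi r₀).indicator U r ^ 2 + (V r - μ) * w r ^ 2 with hG
  have hwnc : Continuous fun x : EuclideanSpace ℝ (Fin n) => w ‖x - x₀‖ := by fun_prop
  have hVw : Continuous fun x : EuclideanSpace ℝ (Fin n) => V ‖x - x₀‖ * w ‖x - x₀‖ ^ 2 :=
    continuous_radial_mul_sq hVc hwnc hr₀ fun x hx => hwlo _ (by
      rw [← dist_eq_norm]; exact (Metric.mem_ball.1 hx).le)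
  have hintE : ∀ D : Set (EuclideanSpace ℝ (Fin n)), Bornology.IsBounded D →
      IntegrableOn (fun x => (Ioi r₀).indicator U ‖x - x₀‖ ^ 2 + V ‖x - x₀‖ * w ‖x - x₀‖ ^ 2) D :=
    fun D hD => by
      refine Integrable.add ?_ (integrableOn_of_continuous_of_isBounded hD hVw)
      have h1 : IntegrableOn (fun x => U ‖x - x₀‖ ^ 2) D :=
        integrableOn_of_continuous_of_isBounded hD (by fun_prop)
      have h2 : MeasurableSet {x : EuclideanSpace ℝ (Fin n) | r₀ < ‖x - x₀‖} :=
        (isOpen_lt continuous_const (by fun_prop)).measurableSet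
      refine (h1.indicator h2).congr (Filter.Eventually.of_forall fun x => ?_)
      by_cases h : r₀ < ‖x - x₀‖ <;> simp [indicator, h]
  have hintw : ∀ D : Set (EuclideanSpace ℝ (Fin n)), Bornology.IsBounded D →
      IntegrableOn (fun x => μ * w ‖x - x₀‖ ^ 2) D :=
    fun D hD => integrableOn_of_continuous_of_isBounded hD (by fun_prop)
  have hGeq : ∀ x : EuclideanSpace ℝ (Fin n), G ‖x - x₀‖ =
      ((Ioi r₀).indicator U ‖x - x₀‖ ^ 2 + V ‖x - x₀‖ * w ‖x - x₀‖ ^ 2) - μ * w ‖x - x₀‖ ^ 2 :=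
    fun x => by simp only [hG]; ring
  have hintG : ∀ D : Set (EuclideanSpace ℝ (Fin n)), Bornology.IsBounded D →
      IntegrableOn (fun x => G ‖x - x₀‖) D := fun D hD => by
    simp only [hGeq]
    exact (hintE D hD).sub (hintw D hD)
  have hGmid : ∀ t ∈ Ioc r₀ R, G t = (P t / t ^ (n - 1)) ^ 2 + (V t - μ) * u t ^ 2 := by
    intro t ht
    have ht' := Ioc_subset_Icc_self ht
    simp only [hG, indicator_of_mem (mem_Ioi.2 ht.1), hUdef, hwdef, hκmid t ht']
  have hGlo : ∀ t ≤ r₀, G t = 0 := fun t ht => by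
    simp [hG, hwlo t ht, indicator_of_notMem (show t ∉ Ioi r₀ by simpa using ht)]
  have hlevel : ∫ x in Ω, G ‖x - x₀‖ ≤ ∫ x in Metric.ball x₀ R, G ‖x - x₀‖ := by
    refine setIntegral_le_of_level (c := (V R - μ) * u R ^ 2) hΩm measurableSet_ball hvol
      hΩ.measure_lt_top.ne (hintG Ω hΩ) (hintG _ Metric.isBounded_ball) (fun x hx => ?_)
      fun x hx => ?_
    · rw [Metric.mem_ball, dist_eq_norm] at hx
      rcases le_or_gt ‖x - x₀‖ r₀ with h | h
      · rw [hGlo _ h]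
        exact mul_nonpos_of_nonpos_of_nonneg (by linarith) (sq_nonneg _)
      · rw [hGmid _ ⟨h, hx.le⟩]
        simpa [hPR] using hanti ⟨h.le, hx.le⟩ (right_mem_Icc.2 hR.le) hx.le
    · rw [Metric.mem_ball, dist_eq_norm, not_lt] at hx
      simp only [hG, hwdef, hκhi _ hx]
      have h0 : (Ioi r₀).indicator U ‖x - x₀‖ = 0 := by simp [indicator, hUhi _ hx]
      rw [h0, zero_pow two_ne_zero, zero_add]
      refine mul_le_mul_of_nonneg_right (sub_le_sub_right ?_ μ) (sq_nonneg _)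
      exact hVanti (mem_Ioi.2 (hr₀.trans hR)) (mem_Ioi.2 ((hr₀.trans hR).trans_le hx)) hx
  have hradial : ∫ t in r₀..R, t ^ (n - 1) * ((P t / t ^ (n - 1)) ^ 2 + (V t - μ) * u t ^ 2) = 0 := by
    have hVt : ContinuousOn V (Icc r₀ R) := hVc.mono fun t ht => hr₀.trans_le ht.1
    rw [intervalIntegral.integral_eq_sub_of_hasDerivAt (f := fun t => u t * P t)]
    · simp [hPR, hu0]
    · intro t ht
      rw [uIcc_of_le hR.le] at ht
      refine ((hu t ht).mul (hP t ht)).congr_deriv ?_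
      have := (pow_pos (hr₀.trans_le ht.1) (n - 1)).ne'
      field_simp
    · refine ContinuousOn.intervalIntegrable ?_
      rw [uIcc_of_le hR.le]
      fun_prop
  have hball : ∫ x in Metric.ball x₀ R, G ‖x - x₀‖ = 0 := by
    have : Nonempty (Fin n) := ⟨⟨0, by omega⟩⟩
    rw [← integral_indicator measurableSet_ball, ← integral_add_left_eq_self _ x₀]
    have h1 : ∀ y : EuclideanSpace ℝ (Fin n),
        (Metric.ball x₀ R).indicator (fun x => G ‖x - x₀‖) (x₀ + y) = (Iio R).indicator G ‖y‖ :=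
      fun y => by by_cases h : ‖y‖ < R <;> simp [indicator, h]
    simp only [h1]
    rw [integral_fun_norm_addHaar volume ((Iio R).indicator G), finrank_euclideanSpace_fin]
    have h2 : ∫ y in Ioi (0 : ℝ), y ^ (n - 1) • (Iio R).indicator G y = 0 := by
      rw [intervalIntegral.integral_of_le hR.le, integral_Ioc_eq_integral_Ioo] at hradial
      refine Eq.trans ?_ hradial
      rw [← integral_indicator measurableSet_Ioi, ← integral_indicator measurableSet_Ioo]
      congr 1
      ext t
      by_cases ht : t ∈ Ioo r₀ R
      · rw [indicator_of_mem ht, indicator_of_mem (mem_Ioi.2 (hr₀.trans ht.1)),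
          indicator_of_mem (mem_Iio.2 ht.2), hGmid t (Ioo_subset_Ioc_self ht), smul_eq_mul]
      · rw [indicator_of_notMem ht]
        have h3 : (Iio R).indicator G t = 0 := by
          by_cases h4 : t < R
          · rw [indicator_of_mem (mem_Iio.2 h4)]
            exact hGlo t (not_lt.1 fun h5 => ht ⟨h5, h4⟩)
          · exact indicator_of_notMem (by simpa using h4) _
        rw [indicator_apply, h3, smul_zero, ite_self]
    rw [h2, smul_zero, smul_zero]
  rw [hball] at hlevel
  simp only [hGeq] at hlevel
  rw [integral_sub (hintE Ω hΩ) (hintw Ω hΩ), integral_const_mul] at hlevel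
  exact le_of_mul_le_mul_right (by linarith) hwpos

/-- The set of Rayleigh quotients of a ball is nonempty. -/
theorem exists_test_function_ball {n : ℕ} (hn : 1 ≤ n) (x₀ : EuclideanSpace ℝ (Fin n)) {R : ℝ}
    (hR : 0 < R) : ∃ f : EuclideanSpace ℝ (Fin n) → ℝ, ContDiff ℝ (⊤ : ℕ∞) f ∧
      (∃ ε > 0, ∀ x ∈ Metric.ball x₀ ε, f x = 0) ∧ 0 < ∫ x in Metric.ball x₀ R, f x ^ 2 := by
  have hs : ContDiff ℝ (⊤ : ℕ∞) fun r : ℝ => Real.smoothTransition (r - R / 2) :=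
    Real.smoothTransition.contDiff.comp (contDiff_id.sub contDiff_const)
  have hz : ∀ r ≤ R / 2, Real.smoothTransition (r - R / 2) = 0 := fun r hr =>
    Real.smoothTransition.zero_of_nonpos (by linarith)
  refine ⟨fun x => Real.smoothTransition (‖x - x₀‖ - R / 2), contDiff_radial hs (half_pos hR) hz,
    ⟨R / 2, half_pos hR, fun x hx => hz _ ?_⟩, ?_⟩
  · rw [← dist_eq_norm]; exact (Metric.mem_ball.1 hx).le
  · exact integral_radial_sq_pos hn (half_pos hR).le (half_lt_self hR) Metric.isBounded_ball rfl
      hs.continuous fun r hr => Real.smoothTransition.pos_of_pos (by linarith)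

/-- A continuous function that is positive at the right endpoint but not everywhere has a last
zero. -/
theorem exists_last_zero {u : ℝ → ℝ} {δ R : ℝ} (hu : ContinuousOn u (Icc δ R))
    (hR : 0 < u R) (h : ∃ t ∈ Icc δ R, u t ≤ 0) :
    ∃ r₀ ∈ Ico δ R, u r₀ = 0 ∧ ∀ t ∈ Ioc r₀ R, 0 < u t := by
  have hzero : ∀ t ∈ Icc δ R, u t ≤ 0 → ∃ z ∈ Icc t R, u z = 0 := fun t ht h0 =>
    intermediate_value_Icc ht.2 (hu.mono (Icc_subset_Icc_left ht.1))
      (show (0 : ℝ) ∈ Icc (u t) (u R) from ⟨h0, hR.le⟩)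
  have hZc : IsCompact (Icc δ R ∩ u ⁻¹' {0}) :=
    isCompact_Icc.of_isClosed_subset (hu.preimage_isClosed_of_isClosed isClosed_Icc
      isClosed_singleton) inter_subset_left
  obtain ⟨t, ht, h0⟩ := h
  obtain ⟨z, hz, hz0⟩ := hzero t ht h0
  have hmem := hZc.sSup_mem
    (show (Icc δ R ∩ u ⁻¹' {0}).Nonempty from ⟨z, ⟨ht.1.trans hz.1, hz.2⟩, hz0⟩)
  set r₀ := sSup (Icc δ R ∩ u ⁻¹' {0})
  have hr0 : u r₀ = 0 := hmem.2
  refine ⟨r₀, ⟨hmem.1.1, hmem.1.2.lt_of_ne fun h => ?_⟩, hr0, fun s hs => ?_⟩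
  · rw [h] at hr0; exact hR.ne' hr0
  · by_contra! hle
    obtain ⟨y, hy, hy0⟩ := hzero s ⟨hmem.1.1.trans hs.1.le, hs.2⟩ hle
    have := le_csSup hZc.bddAbove
      (show y ∈ Icc δ R ∩ u ⁻¹' {0} from ⟨⟨hmem.1.1.trans (hs.1.le.trans hy.1), hy.2⟩, hy0⟩)
    exact absurd this (not_le.2 (hs.1.trans_le hy.1))

/-- Isoperimetric inequality for Schrödinger operators with radial, nonnegative,
radially nonincreasing potential: the ball centered at x₀ maximizes the first Neumann
eigenvalue among domains of given volume. -/
theorem schrodinger_isoperimetric (n : ℕ) (hn : 2 ≤ n)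
    (Ω : Set (EuclideanSpace ℝ (Fin n))) (hopen : IsOpen Ω) (hbdd : Bornology.IsBounded Ω)
    (hsmooth : HasSmoothBoundary Ω)
    (x₀ : EuclideanSpace ℝ (Fin n)) (R : ℝ) (hR : 0 < R)
    (hvol : volume (Metric.ball x₀ R) = volume Ω)
    (V : ℝ → ℝ)
    (hVd : ∀ r ∈ Ioi (0 : ℝ), DifferentiableAt ℝ V r)
    (hV'c : ContinuousOn (deriv V) (Ioi 0))
    (hVpos : ∀ r ∈ Ioi (0 : ℝ), 0 ≤ V r)
    (hV' : ∀ r ∈ Ioi (0 : ℝ), deriv V r ≤ 0)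
    (hcond : ∀ r ∈ Ioo 0 R, ((n : ℝ) - 1) * deriv V r + 2 * r * (V r) ^ 2 ≤ 0)
    (u : ℝ → ℝ)
    (hud : ∀ r ∈ Ioc 0 R, DifferentiableAt ℝ u r)
    (hud2 : ∀ r ∈ Ioc 0 R, DifferentiableAt ℝ (deriv u) r)
    (hu''c : ContinuousOn (deriv (deriv u)) (Ioc 0 R))
    (hupos : ∀ r ∈ Ioo 0 R, 0 ≤ u r)
    (hu'pos : ∀ r ∈ Ioo 0 R, 0 ≤ deriv u r)
    (hneu : deriv u R = 0)
    (hlim : Filter.Tendsto (fun r => r ^ (n - 1) * u r * deriv u r)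
      (nhdsWithin 0 (Ioi 0)) (nhds 0))
    (heq : ∀ r ∈ Ioo 0 R,
      deriv (deriv u) r + (((n : ℝ) - 1) / r) * deriv u r +
        (lam1Schrodinger x₀ V (Metric.ball x₀ R) - V r) * u r = 0) :
    lam1Schrodinger x₀ V Ω ≤ lam1Schrodinger x₀ V (Metric.ball x₀ R) := by
  have hVc : ContinuousOn V (Ioi 0) := fun r hr => (hVd r hr).continuousAt.continuousWithinAt
  refine le_of_forall_gt_imp_ge_of_dense fun μ hμ => ?_
  obtain ⟨g, hgs, hg0, hgpos⟩ := exists_test_function_ball (by omega : 1 ≤ n) x₀ hR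
  have hμ0 : 0 ≤ μ := (lam1Schrodinger_nonneg hVpos _).trans hμ.le
  rw [lam1Schrodinger] at hμ
  obtain ⟨q, ⟨f, hfs, ⟨ε, hε, hf0⟩, hfpos, rfl⟩, hq⟩ :=
    exists_lt_of_csInf_lt (by exact ⟨_, g, hgs, hg0, hgpos, rfl⟩) hμ
  rw [div_lt_iff₀ hfpos] at hq
  obtain ⟨δ, hδ, hδε, hδR⟩ : ∃ δ, 0 < δ ∧ δ < ε ∧ δ < R :=
    ⟨min ε R / 2, by positivity, by linarith [min_le_left ε R, lt_min hε hR],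
      by linarith [min_le_right ε R, lt_min hε hR]⟩
  have hpos : ∀ t ∈ Icc (δ / 2) (R + 1), 0 < t := fun t ht => (half_pos hδ).trans_le ht.1
  have hVcI : ContinuousOn V (Icc (δ / 2) (R + 1)) := hVc.mono hpos
  obtain ⟨v, P, hvR, hPR, hsol⟩ := exists_linear_system (b := fun t => (t ^ (n - 1))⁻¹)
    (c := fun t => (V t - μ) * t ^ (n - 1)) (A := δ / 2) (B := R + 1) (R := R)
    ⟨by linarith, by linarith⟩
    (ContinuousOn.inv₀ (by fun_prop) fun t ht => (pow_pos (hpos t ht) _).ne') (by fun_prop)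
  have hI : Icc δ R ⊆ Ioo (δ / 2) (R + 1) := fun t ht => ⟨by linarith [ht.1], by linarith [ht.2]⟩
  have hv : ∀ t ∈ Icc δ R, HasDerivAt v (P t / t ^ (n - 1)) t := fun t ht => by
    rw [div_eq_inv_mul]; exact (hsol t (hI ht)).1
  have hP : ∀ t ∈ Icc δ R, HasDerivAt P ((V t - μ) * t ^ (n - 1) * v t) t := fun t ht =>
    (hsol t (hI ht)).2.1
  obtain ⟨r₀, hr₀, hvr₀, hvpos⟩ := exists_last_zero
    (fun t ht => (hv t ht).continuousAt.continuousWithinAt) (by rw [hvR]; exact one_pos) (by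
      by_contra! hcon
      exact absurd hq (not_lt.2 (mul_integral_sq_le_energy_ball (by omega) hδ hδε hδR hVc hv hP
        hPR hcon hfs hf0)))
  have hsub : Icc r₀ R ⊆ Icc δ R := Icc_subset_Icc_left hr₀.1
  exact lam1Schrodinger_le_of_solution hn hopen.measurableSet hbdd (hδ.trans_le hr₀.1) hr₀.2 hvol
    hμ0 hVd hVpos hV' hcond (fun t ht => hv t (hsub ht)) (fun t ht => hP t (hsub ht)) hPR hvr₀
    hvpos ((hsol r₀ (hI ⟨hr₀.1, hr₀.2.le⟩)).2.2 hvr₀)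
end

section
/- Fix ν ∈ ℝ and k ∈ ℤ, set μ = |k − ν|, and define ψ : ℝ² \ {0} → ℂ by ψ(x) = |x|^{μ} · ((x₁ + i x₂)/|x|)^{k}. Let A(x) = ν·(−x₂, x₁)/|x|². Then: (i) at every x ∈ ℝ² \ {0}, −(∂²ψ/∂x₁² + ∂²ψ/∂x₂²)(x) + |A(x)|² ψ(x) + 2i (A₁(x) ∂₁ψ(x) + A₂(x) ∂₂ψ(x)) = 0, i.e. ψ is in the kernel of the magnetic Laplacian Δ_A; (ii) for every x with |x| = 1, ⟨∇ψ(x) − i ψ(x) A(x), x⟩ = μ · ψ(x), i.e. ψ satisfies the magnetic Steklov boundary condition on the unit circle with eigenvalue μ = |k − ν|. -/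
/-- The Aharonov–Bohm potential with pole at the origin and flux ν. -/
noncomputable def ABO (ν : ℝ) (x : EuclideanSpace ℝ (Fin 2)) : Fin 2 → ℝ := fun i =>
  if i = 0 then -ν * x 1 / ‖x‖ ^ 2 else ν * x 0 / ‖x‖ ^ 2

/-- The Steklov eigenfunction ψ(x) = |x|^{|k−ν|} ((x₁+ix₂)/|x|)^k of the unit disk. -/
noncomputable def steklovEigenfunction (ν : ℝ) (k : ℤ) (x : EuclideanSpace ℝ (Fin 2)) : ℂ :=
  ((‖x‖ ^ |(k : ℝ) - ν| : ℝ) : ℂ) * ((((x 0 : ℝ) : ℂ) + ((x 1 : ℝ) : ℂ) * Complex.I) / ((‖x‖ : ℝ) : ℂ)) ^ k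

/-- The complex coordinate `x ↦ x₀ + x₁ i` on the Euclidean plane, as a real-linear map. -/
noncomputable def complexCoord : EuclideanSpace ℝ (Fin 2) →L[ℝ] ℂ :=
  Complex.ofRealCLM.comp (EuclideanSpace.proj 0) +
    (Complex.ofRealCLM.comp (EuclideanSpace.proj 1)).smulRight Complex.I

theorem complexCoord_apply (x : EuclideanSpace ℝ (Fin 2)) :
    complexCoord x = (x 0 : ℂ) + (x 1 : ℂ) * Complex.I := by
  simp [complexCoord]

theorem complexCoord_mul_conj (x : EuclideanSpace ℝ (Fin 2)) :
    complexCoord x * ((x 0 : ℂ) - (x 1 : ℂ) * Complex.I) = ((‖x‖ ^ 2 : ℝ) : ℂ) := by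
  rw [complexCoord_apply, EuclideanSpace.real_norm_sq_eq, Fin.sum_univ_two]
  push_cast
  linear_combination (-(x 1 : ℂ) ^ 2) * Complex.I_sq

theorem complexCoord_ne_zero {x : EuclideanSpace ℝ (Fin 2)} (hx : x ≠ 0) :
    complexCoord x ≠ 0 := by
  intro h
  have := complexCoord_mul_conj x
  rw [h, zero_mul] at this
  exact pow_ne_zero 2 (norm_ne_zero_iff.mpr hx) (by exact_mod_cast this.symm)

theorem steklovEigenfunction_eq (ν : ℝ) (k : ℤ) {x : EuclideanSpace ℝ (Fin 2)} (hx : x ≠ 0) :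
    steklovEigenfunction ν k x =
      (((‖x‖ ^ 2) ^ ((|(k : ℝ) - ν| - k) / 2) : ℝ) : ℂ) * complexCoord x ^ k := by
  have hr : 0 < ‖x‖ := norm_pos_iff.mpr hx
  have hpow : (‖x‖ ^ 2) ^ ((|(k : ℝ) - ν| - k) / 2) = ‖x‖ ^ |(k : ℝ) - ν| / ‖x‖ ^ k := by
    rw [← Real.rpow_natCast, ← Real.rpow_mul hr.le, ← Real.rpow_intCast, ← Real.rpow_sub hr]
    congr 1
    push_cast
    ring
  rw [hpow, steklovEigenfunction, complexCoord_apply, div_zpow]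
  push_cast
  ring

/-- The logarithmic derivative of the Steklov eigenfunction at `x` in the direction `v`. -/
noncomputable def steklovLogDeriv (ν : ℝ) (k : ℤ) (v x : EuclideanSpace ℝ (Fin 2)) : ℂ :=
  ((|(k : ℝ) - ν| - k : ℝ) : ℂ) * ((inner ℝ x v / ‖x‖ ^ 2 : ℝ) : ℂ) +
    k * (complexCoord v / complexCoord x)

theorem differentiableAt_steklovEigenfunction (ν : ℝ) (k : ℤ) {x : EuclideanSpace ℝ (Fin 2)}
    (hx : x ≠ 0) :
    DifferentiableAt ℝ (steklovEigenfunction ν k) x ∧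
      ∀ v, fderiv ℝ (steklovEigenfunction ν k) x v =
        steklovEigenfunction ν k x * steklovLogDeriv ν k v x := by
  have hn : ‖x‖ ^ 2 ≠ 0 := by simpa using hx
  have hz := complexCoord_ne_zero hx
  have hrad := Complex.ofRealCLM.hasFDerivAt.comp x
    ((hasStrictFDerivAt_norm_sq x).hasFDerivAt.rpow_const
      (p := (|(k : ℝ) - ν| - k) / 2) (Or.inl hn))
  have hang := (hasDerivAt_zpow k (complexCoord x) (Or.inl hz)).comp_hasFDerivAt x
    complexCoord.hasFDerivAt
  have hψ := (hrad.mul hang).congr_of_eventuallyEq (f₁ := steklovEigenfunction ν k) (by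
    filter_upwards [isOpen_ne.mem_nhds hx] with y hy
    simpa using steklovEigenfunction_eq ν k hy)
  refine ⟨hψ.differentiableAt, fun v => ?_⟩
  rw [hψ.fderiv, steklovEigenfunction_eq ν k hx, steklovLogDeriv]
  simp only [Function.comp_apply, add_apply, smul_apply,
    ContinuousLinearMap.comp_apply, Complex.ofRealCLM_apply, smul_eq_mul, coe_innerSL_apply,
    nsmul_eq_mul, Real.rpow_sub_one hn, zpow_sub_one₀ hz]
  have hn' : (‖x‖ : ℂ) ≠ 0 := by simpa using hx
  push_cast
  field_simp
  ring

theorem fderiv_steklovLogDeriv (ν : ℝ) (k : ℤ) (v : EuclideanSpace ℝ (Fin 2))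
    {x : EuclideanSpace ℝ (Fin 2)} (hx : x ≠ 0) :
    DifferentiableAt ℝ (steklovLogDeriv ν k v) x ∧
      fderiv ℝ (steklovLogDeriv ν k v) x v =
        ((|(k : ℝ) - ν| - k : ℝ) : ℂ) *
            ((‖v‖ ^ 2 / ‖x‖ ^ 2 - 2 * (inner ℝ x v / ‖x‖ ^ 2) ^ 2 : ℝ) : ℂ) -
          k * (complexCoord v / complexCoord x) ^ 2 := by
  have hn : ‖x‖ ^ 2 ≠ 0 := by simpa using hx
  have hz := complexCoord_ne_zero hx
  have hrad := (Complex.ofRealCLM.hasFDerivAt.comp x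
    (((innerSL ℝ v).hasFDerivAt (x := x)).mul
      ((hasDerivAt_inv hn).comp_hasFDerivAt x (hasStrictFDerivAt_norm_sq x).hasFDerivAt))).const_mul
      ((|(k : ℝ) - ν| - k : ℝ) : ℂ)
  have hang := (((hasDerivAt_inv hz).comp_hasFDerivAt x
    complexCoord.hasFDerivAt).const_mul (complexCoord v)).const_mul (k : ℂ)
  have hL := (hrad.add hang).congr_of_eventuallyEq (f₁ := steklovLogDeriv ν k v) (by
    filter_upwards with y
    simp [steklovLogDeriv, div_eq_mul_inv, real_inner_comm])
  refine ⟨hL.differentiableAt, ?_⟩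
  rw [hL.fderiv]
  simp only [Function.comp_apply, add_apply, smul_apply,
    ContinuousLinearMap.comp_apply, Complex.ofRealCLM_apply, smul_eq_mul, coe_innerSL_apply,
    nsmul_eq_mul, real_inner_self_eq_norm_sq, real_inner_comm v x]
  have hn' : (‖x‖ : ℂ) ≠ 0 := by simpa using hx
  push_cast
  field_simp
  ring

theorem fderiv_fderiv_steklovEigenfunction (ν : ℝ) (k : ℤ) (v : EuclideanSpace ℝ (Fin 2))
    {x : EuclideanSpace ℝ (Fin 2)} (hx : x ≠ 0) :
    fderiv ℝ (fun y => fderiv ℝ (steklovEigenfunction ν k) y v) x v =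
      steklovEigenfunction ν k x *
        (steklovLogDeriv ν k v x ^ 2 + fderiv ℝ (steklovLogDeriv ν k v) x v) := by
  obtain ⟨hd, hψ⟩ := differentiableAt_steklovEigenfunction ν k hx
  have hL := (fderiv_steklovLogDeriv ν k v hx).1
  have heq : (fun y => fderiv ℝ (steklovEigenfunction ν k) y v) =ᶠ[nhds x]
      steklovEigenfunction ν k * steklovLogDeriv ν k v := by
    filter_upwards [isOpen_ne.mem_nhds hx] with y hy
    exact (differentiableAt_steklovEigenfunction ν k hy).2 v
  rw [heq.fderiv_eq, fderiv_mul hd hL]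
  simp only [add_apply, smul_apply, smul_eq_mul, hψ]
  ring

/-- ψ is magnetic-harmonic on ℝ² \ {0} and satisfies the magnetic Steklov boundary
condition on the unit circle with eigenvalue |k − ν|. -/
theorem steklov_eigenfunction_disk (ν : ℝ) (k : ℤ) :
    (∀ x : EuclideanSpace ℝ (Fin 2), x ≠ 0 →
      -(fderiv ℝ (fun y => fderiv ℝ (steklovEigenfunction ν k) y (EuclideanSpace.single 0 1)) x
            (EuclideanSpace.single 0 1) +
        fderiv ℝ (fun y => fderiv ℝ (steklovEigenfunction ν k) y (EuclideanSpace.single 1 1)) x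
            (EuclideanSpace.single 1 1)) +
        ((ν ^ 2 / ‖x‖ ^ 2 : ℝ) : ℂ) * steklovEigenfunction ν k x +
        2 * Complex.I *
          (((ABO ν x 0 : ℝ) : ℂ) *
              fderiv ℝ (steklovEigenfunction ν k) x (EuclideanSpace.single 0 1) +
            ((ABO ν x 1 : ℝ) : ℂ) *
              fderiv ℝ (steklovEigenfunction ν k) x (EuclideanSpace.single 1 1)) = 0) ∧
    (∀ x : EuclideanSpace ℝ (Fin 2), ‖x‖ = 1 →
      ∑ i : Fin 2,
          (fderiv ℝ (steklovEigenfunction ν k) x (EuclideanSpace.single i 1) -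
              Complex.I * steklovEigenfunction ν k x * ((ABO ν x i : ℝ) : ℂ)) * ((x i : ℝ) : ℂ) =
        ((|(k : ℝ) - ν| : ℝ) : ℂ) * steklovEigenfunction ν k x) := by
  refine ⟨fun x hx => ?_, fun x hx => ?_⟩
  · have hn : (‖x‖ : ℂ) ≠ 0 := by simpa using hx
    have hz := complexCoord_ne_zero hx
    have hconj := complexCoord_mul_conj x
    have hnorm : (‖x‖ : ℂ) ^ 2 = (x 0 : ℂ) ^ 2 + (x 1 : ℂ) ^ 2 := by
      exact_mod_cast (by simp [EuclideanSpace.real_norm_sq_eq] : ‖x‖ ^ 2 = x 0 ^ 2 + x 1 ^ 2)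
    have hμ : ((|(k : ℝ) - ν| : ℝ) : ℂ) ^ 2 = ((k : ℂ) - ν) ^ 2 := by
      exact_mod_cast sq_abs ((k : ℝ) - ν)
    have hinv : (complexCoord x)⁻¹ = ((x 0 : ℂ) - (x 1 : ℂ) * Complex.I) / (‖x‖ : ℂ) ^ 2 := by
      rw [Complex.ofReal_pow] at hconj
      field_simp
      rw [← hconj]
    simp only [fderiv_fderiv_steklovEigenfunction ν k _ hx, (fderiv_steklovLogDeriv ν k _ hx).2,
      (differentiableAt_steklovEigenfunction ν k hx).2, steklovLogDeriv, ABO]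
    generalize steklovEigenfunction ν k x = ψ
    generalize ((|(k : ℝ) - ν| : ℝ)) = μ at hμ ⊢
    simp only [div_eq_mul_inv (complexCoord _), hinv]
    simp [complexCoord_apply, EuclideanSpace.inner_single_right]
    field_simp
    rw [hnorm]
    linear_combination -ψ * ((x 0 : ℂ) ^ 2 + (x 1 : ℂ) ^ 2) * hμ + ψ * k *
      ((1 - k) * (x 1 : ℂ) ^ 2 * Complex.I ^ 2 + 2 * (k - ν - 1) * x 0 * x 1 * Complex.I +
        2 * (μ + ν - k) * (x 1 : ℂ) ^ 2 + (1 + 2 * ν - k) * (x 0 : ℂ) ^ 2) * Complex.I_sq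
  · have hx0 : x ≠ 0 := by
      rintro rfl
      simp at hx
    have hz := complexCoord_ne_zero hx0
    have hnorm : (x 0 : ℂ) ^ 2 + (x 1 : ℂ) ^ 2 = 1 := by
      have := EuclideanSpace.real_norm_sq_eq x
      rw [hx, one_pow, Fin.sum_univ_two] at this
      exact_mod_cast congrArg ((↑) : ℝ → ℂ) this.symm
    have hsum : complexCoord x * (complexCoord x)⁻¹ = 1 := mul_inv_cancel₀ hz
    simp only [(differentiableAt_steklovEigenfunction ν k hx0).2, steklovLogDeriv, ABO,
      Fin.sum_univ_two, hx]
    generalize steklovEigenfunction ν k x = ψ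
    generalize ((|(k : ℝ) - ν| : ℝ)) = μ
    simp only [div_eq_mul_inv (complexCoord _)]
    generalize (complexCoord x)⁻¹ = w at *
    rw [complexCoord_apply] at hsum
    simp [complexCoord_apply, EuclideanSpace.inner_single_right]
    linear_combination ψ * (μ - k) * hnorm + ψ * k * hsum
end

section
/- (Equivalence of magnetic and weighted Sobolev norms.) Let Ω ⊂ ℝ² be a bounded open set with smooth boundary, x₀ ∈ Ω, and ν ∈ ℝ with ν ∉ ℤ. Then there exist constants c, C > 0 such that for every u ∈ C^∞(ℝ², ℂ) vanishing on a neighborhood of x₀: c·(∫_Ω |∇u|² + |u|² + |u|²/|x−x₀|² dx) ≤ ∫_Ω |∇u − i u A_{x₀,ν}|² + |u|² dx ≤ C·(∫_Ω |∇u|² + |u|² + |u|²/|x−x₀|² dx). -/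
open MeasureTheory

noncomputable def AB (x₀ : EuclideanSpace ℝ (Fin 2)) (ν : ℝ)
    (x : EuclideanSpace ℝ (Fin 2)) : Fin 2 → ℝ := fun i =>
  if i = 0 then -ν * (x 1 - x₀ 1) / ‖x - x₀‖ ^ 2 else ν * (x 0 - x₀ 0) / ‖x - x₀‖ ^ 2

noncomputable def magGradSq (A : EuclideanSpace ℝ (Fin 2) → Fin 2 → ℝ)
    (u : EuclideanSpace ℝ (Fin 2) → ℂ) (x : EuclideanSpace ℝ (Fin 2)) : ℝ :=
  ∑ i : Fin 2, ‖fderiv ℝ u x (EuclideanSpace.single i 1) - Complex.I * u x * (A x i)‖ ^ 2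

def VanishesNear (x₀ : EuclideanSpace ℝ (Fin 2)) (u : EuclideanSpace ℝ (Fin 2) → ℂ) : Prop :=
  ∃ ε > 0, ∀ x ∈ Metric.ball x₀ ε, u x = 0

noncomputable def lambda1 (x₀ : EuclideanSpace ℝ (Fin 2)) (ν : ℝ)
    (D : Set (EuclideanSpace ℝ (Fin 2))) : ℝ :=
  sInf {q | ∃ u : EuclideanSpace ℝ (Fin 2) → ℂ, ContDiff ℝ (⊤ : ℕ∞) u ∧ VanishesNear x₀ u ∧
    0 < ∫ x in D, ‖u x‖ ^ 2 ∧
    q = (∫ x in D, magGradSq (AB x₀ ν) u x) / ∫ x in D, ‖u x‖ ^ 2}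

noncomputable def sigma1 (x₀ : EuclideanSpace ℝ (Fin 2)) (ν : ℝ)
    (D : Set (EuclideanSpace ℝ (Fin 2))) : ℝ :=
  sInf {q | ∃ u : EuclideanSpace ℝ (Fin 2) → ℂ, ContDiff ℝ (⊤ : ℕ∞) u ∧ VanishesNear x₀ u ∧
    0 < ∫ x in frontier D, ‖u x‖ ^ 2 ∂(μH[1]) ∧
    q = (∫ x in D, magGradSq (AB x₀ ν) u x) / ∫ x in frontier D, ‖u x‖ ^ 2 ∂(μH[1])}

noncomputable def distInt (ν : ℝ) : ℝ := ⨅ k : ℤ, |ν - (k : ℝ)|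

theorem sq_intervalIntegral_le {h : ℝ → ℝ} (hh : Continuous h) {a b : ℝ} (hab : a < b) :
    (∫ t in a..b, h t) ^ 2 ≤ (b - a) * ∫ t in a..b, h t ^ 2 := by
  set J := ∫ t in a..b, h t
  have hpos : 0 < b - a := sub_pos.2 hab
  have h0 : 0 ≤ ∫ t in a..b, ((b - a) * h t - J) ^ 2 :=
    intervalIntegral.integral_nonneg hab.le fun t _ => sq_nonneg _
  have h1 : ∫ t in a..b, ((b - a) * h t - J) ^ 2 =
      (b - a) ^ 2 * (∫ t in a..b, h t ^ 2) - 2 * (b - a) * J * J + (b - a) * J ^ 2 := by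
    have : ∀ t, ((b - a) * h t - J) ^ 2 =
        (b - a) ^ 2 * h t ^ 2 - 2 * (b - a) * J * h t + J ^ 2 := fun t => by ring
    simp_rw [this]
    rw [intervalIntegral.integral_add (Continuous.intervalIntegrable (by fun_prop) _ _)
        (Continuous.intervalIntegrable (by fun_prop) _ _),
      intervalIntegral.integral_sub (Continuous.intervalIntegrable (by fun_prop) _ _)
        (Continuous.intervalIntegrable (by fun_prop) _ _),
      intervalIntegral.integral_const_mul, intervalIntegral.integral_const_mul,
      intervalIntegral.integral_const, smul_eq_mul]
  rw [h1] at h0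
  have h2 : 0 ≤ (b - a) * ((b - a) * (∫ t in a..b, h t ^ 2) - J ^ 2) := by linarith
  linarith [nonneg_of_mul_nonneg_right h2 hpos]

theorem sin_mul_pi_ne_zero {ν : ℝ} (hν : ∀ k : ℤ, (k : ℝ) ≠ ν) : Real.sin (ν * Real.pi) ≠ 0 := by
  rw [Real.sin_ne_zero_iff]
  intro n hn
  exact hν n (mul_right_cancel₀ Real.pi_ne_zero hn)

/-- Poincaré inequality for the operator `d/dθ - iν` on the circle. -/
theorem integral_norm_sq_le_of_periodic {ν : ℝ} (hν : ∀ k : ℤ, (k : ℝ) ≠ ν) {f f' : ℝ → ℂ}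
    (hf : ∀ t, HasDerivAt f (f' t) t) (hf' : Continuous f')
    (hper : f (-Real.pi) = f Real.pi) :
    ∫ t in (-Real.pi)..Real.pi, ‖f t‖ ^ 2 ≤
      (2 * Real.pi * (1 + (2 * |Real.sin (ν * Real.pi)|)⁻¹)) ^ 2 *
        ∫ t in (-Real.pi)..Real.pi, ‖f' t - Complex.I * ν * f t‖ ^ 2 := by
  have hπ := Real.pi_pos
  have hππ : -Real.pi < Real.pi := by linarith
  have hfc : Continuous f := continuous_iff_continuousAt.2 fun t => (hf t).continuousAt
  set h : ℝ → ℂ := fun t => f' t - Complex.I * ν * f t with hh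
  have hhc : Continuous h := by fun_prop
  set κ := 2 * |Real.sin (ν * Real.pi)| with hκ
  have hκpos : 0 < κ := by have := abs_pos.2 (sin_mul_pi_ne_zero hν); positivity
  set e : ℝ → ℂ := fun t => Complex.exp ((-(ν * t) : ℝ) * Complex.I) with he
  have hnorm : ∀ t, ‖e t‖ = 1 := fun t => Complex.norm_exp_ofReal_mul_I _
  have hec : Continuous e := by fun_prop
  have hg : ∀ t, HasDerivAt (fun t => e t * f t) (e t * h t) t := by
    intro t
    have h1 : HasDerivAt e (e t * (-(ν : ℂ) * Complex.I)) t := by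
      have : HasDerivAt (fun s : ℝ => ((-(ν * s) : ℝ) : ℂ) * Complex.I) (-(ν : ℂ) * Complex.I) t := by
        have := ((((hasDerivAt_id t).const_mul ν).neg).ofReal_comp).mul_const Complex.I
        simpa using this
      exact this.cexp
    refine (h1.mul (hf t)).congr_deriv ?_
    simp only [hh]
    ring
  set J := ∫ t in (-Real.pi)..Real.pi, ‖h t‖
  have hdiff : ∀ t ∈ Set.Icc (-Real.pi) Real.pi,
      ‖e t * f t - e (-Real.pi) * f (-Real.pi)‖ ≤ J := by
    intro t ht
    rw [← intervalIntegral.integral_eq_sub_of_hasDerivAt (fun s _ => hg s)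
      ((show Continuous fun s => e s * h s from hec.mul hhc).intervalIntegrable _ _)]
    refine (intervalIntegral.norm_integral_le_integral_norm ht.1).trans ?_
    have hnm : ∀ s, ‖e s * h s‖ = ‖h s‖ := fun s => by rw [norm_mul, hnorm, one_mul]
    simp only [hnm]
    exact intervalIntegral.integral_mono_interval le_rfl ht.1 ht.2
      (Filter.Eventually.of_forall fun s => norm_nonneg _) (hhc.norm.intervalIntegrable _ _)
  have hend : ‖f Real.pi‖ ≤ κ⁻¹ * J := by
    have h1 := hdiff Real.pi ⟨hππ.le, le_rfl⟩
    rw [hper, ← sub_mul, norm_mul] at h1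
    have h2 : ‖e Real.pi - e (-Real.pi)‖ = κ := by
      have : e Real.pi - e (-Real.pi) = ((-2 * Real.sin (ν * Real.pi) : ℝ) : ℂ) * Complex.I := by
        simp only [he, Complex.exp_mul_I, ← Complex.ofReal_cos, ← Complex.ofReal_sin]
        simp only [mul_neg, neg_neg, Real.cos_neg, Real.sin_neg]
        push_cast; ring
      rw [this, norm_mul, Complex.norm_I, mul_one, Complex.norm_real, Real.norm_eq_abs, abs_mul]
      norm_num [hκ]
    rw [h2] at h1
    rwa [inv_mul_eq_div, le_div_iff₀' hκpos]
  have hsup : ∀ t ∈ Set.Icc (-Real.pi) Real.pi, ‖f t‖ ≤ (1 + κ⁻¹) * J := by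
    intro t ht
    have h1 := norm_le_norm_add_norm_sub' (e t * f t) (e (-Real.pi) * f (-Real.pi))
    simp only [norm_mul, hnorm, one_mul, hper] at h1
    have h2 := hdiff t ht
    rw [hper] at h2
    linarith
  have hCS : J ^ 2 ≤ 2 * Real.pi * ∫ t in (-Real.pi)..Real.pi, ‖h t‖ ^ 2 := by
    have := sq_intervalIntegral_le hhc.norm hππ
    rwa [show Real.pi - -Real.pi = 2 * Real.pi by ring] at this
  calc ∫ t in (-Real.pi)..Real.pi, ‖f t‖ ^ 2
      ≤ ∫ t in (-Real.pi)..Real.pi, ((1 + κ⁻¹) * J) ^ 2 := by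
        refine intervalIntegral.integral_mono_on hππ.le
          (Continuous.intervalIntegrable (by fun_prop) _ _)
          (Continuous.intervalIntegrable (by fun_prop) _ _) fun t ht => ?_
        exact pow_le_pow_left₀ (norm_nonneg _) (hsup t ht) 2
    _ = 2 * Real.pi * (1 + κ⁻¹) ^ 2 * J ^ 2 := by
        rw [intervalIntegral.integral_const, smul_eq_mul]; ring
    _ ≤ 2 * Real.pi * (1 + κ⁻¹) ^ 2 * (2 * Real.pi * ∫ t in (-Real.pi)..Real.pi, ‖h t‖ ^ 2) := by
        gcongr
    _ = _ := by ring

/-- Polar coordinates centred at `x₀`. -/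
noncomputable def polarMap (x₀ : EuclideanSpace ℝ (Fin 2)) (p : ℝ × ℝ) :
    EuclideanSpace ℝ (Fin 2) :=
  x₀ + !₂[p.1 * Real.cos p.2, p.1 * Real.sin p.2]

theorem continuous_polarMap (x₀ : EuclideanSpace ℝ (Fin 2)) : Continuous (polarMap x₀) := by
  unfold polarMap
  refine continuous_const.add ((PiLp.continuous_toLp 2 _).comp (continuous_pi fun i => ?_))
  fin_cases i <;> simp <;> fun_prop

theorem norm_polarMap_sub (x₀ : EuclideanSpace ℝ (Fin 2)) (p : ℝ × ℝ) :
    ‖polarMap x₀ p - x₀‖ = |p.1| := by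
  rw [polarMap, add_sub_cancel_left, EuclideanSpace.norm_eq, Fin.sum_univ_two,
    ← Real.sqrt_sq_eq_abs]
  congr 1
  simp only [Matrix.cons_val_zero, Matrix.cons_val_one, Real.norm_eq_abs, sq_abs]
  linear_combination p.1 ^ 2 * Real.sin_sq_add_cos_sq p.2

theorem setIntegral_ball_eq_polar (x₀ : EuclideanSpace ℝ (Fin 2)) (R : ℝ)
    (G : EuclideanSpace ℝ (Fin 2) → ℝ) :
    ∫ x in Metric.ball x₀ R, G x =
      ∫ p in Set.Ioo 0 R ×ˢ Set.Ioo (-Real.pi) Real.pi, p.1 * G (polarMap x₀ p) := by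
  let e := Complex.orthonormalBasisOneI.repr
  have he : ∀ p, x₀ + e (Complex.polarCoord.symm p) = polarMap x₀ p := by
    intro p
    rw [polarMap]
    congr 1
  rw [← integral_indicator Metric.isOpen_ball.measurableSet, ← integral_add_left_eq_self _ x₀,
    ← e.measurePreserving.integral_comp e.toHomeomorph.measurableEmbedding,
    ← Complex.integral_comp_polarCoord_symm]
  simp_rw [he, smul_eq_mul]
  have hset : Set.Ioo 0 R ×ˢ Set.Ioo (-Real.pi) Real.pi =
      polarCoord.target ∩ {p : ℝ × ℝ | p.1 < R} := by
    ext p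
    simp only [polarCoord_target, Set.mem_prod, Set.mem_Ioo, Set.mem_inter_iff,
      Set.mem_Ioi, Set.mem_ofPred_eq]
    tauto
  have hmeas : MeasurableSet {p : ℝ × ℝ | p.1 < R} :=
    measurableSet_lt measurable_fst measurable_const
  rw [hset, ← setIntegral_indicator hmeas]
  refine setIntegral_congr_fun polarCoord.open_target.measurableSet fun p hp => ?_
  have hp0 : 0 < p.1 := hp.1
  by_cases h : p.1 < R
  · have h' : polarMap x₀ p ∈ Metric.ball x₀ R := by
      rwa [mem_ball_iff_norm, norm_polarMap_sub, abs_of_pos hp0]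
    simp [Set.indicator, h, h']
  · have h' : polarMap x₀ p ∉ Metric.ball x₀ R := by
      rwa [mem_ball_iff_norm, norm_polarMap_sub, abs_of_pos hp0]
    simp [Set.indicator, h, h']

theorem setIntegral_ball_nonneg_of_circle {x₀ : EuclideanSpace ℝ (Fin 2)} {R : ℝ}
    {G : EuclideanSpace ℝ (Fin 2) → ℝ} (hG : Continuous G)
    (h : ∀ r > 0, 0 ≤ ∫ θ in (-Real.pi)..Real.pi, G (polarMap x₀ (r, θ))) :
    0 ≤ ∫ x in Metric.ball x₀ R, G x := by
  have hc : Continuous fun p : ℝ × ℝ => p.1 * G (polarMap x₀ p) :=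
    continuous_fst.mul (hG.comp (continuous_polarMap x₀))
  rw [setIntegral_ball_eq_polar, Measure.volume_eq_prod, setIntegral_prod]
  · refine setIntegral_nonneg measurableSet_Ioo fun r hr => ?_
    simp only
    rw [integral_const_mul, ← integral_Ioc_eq_integral_Ioo,
      ← intervalIntegral.integral_of_le (by linarith [Real.pi_pos])]
    exact mul_nonneg hr.1.le (h r hr.1)
  · rw [← Measure.volume_eq_prod]
    exact (hc.continuousOn.integrableOn_compact (isCompact_Icc.prod isCompact_Icc)).mono_set
      (Set.prod_mono Set.Ioo_subset_Icc_self Set.Ioo_subset_Icc_self)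

theorem VanishesNear.continuous_of_continuousAt {F : Type*} [TopologicalSpace F] [Zero F]
    {x₀ : EuclideanSpace ℝ (Fin 2)} {u : EuclideanSpace ℝ (Fin 2) → ℂ} (hu : VanishesNear x₀ u)
    {g : EuclideanSpace ℝ (Fin 2) → F} (hg : ∀ x, u x = 0 → g x = 0)
    (hc : ∀ x, x ≠ x₀ → ContinuousAt g x) : Continuous g := by
  obtain ⟨ε, hε, h⟩ := hu
  refine continuous_iff_continuousAt.2 fun x => ?_
  by_cases hx : x = x₀
  · subst hx
    have : g =ᶠ[nhds x] fun _ => 0 :=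
      Filter.eventually_of_mem (Metric.ball_mem_nhds x hε) fun y hy => hg y (h y hy)
    exact continuousAt_const.congr this.symm
  · exact hc x hx

theorem norm_sub_sq_pos {x₀ x : EuclideanSpace ℝ (Fin 2)} (hx : x ≠ x₀) : 0 < ‖x - x₀‖ ^ 2 :=
  pow_pos (norm_pos_iff.2 (sub_ne_zero.2 hx)) 2

theorem continuous_hardyWeight {x₀ : EuclideanSpace ℝ (Fin 2)}
    {u : EuclideanSpace ℝ (Fin 2) → ℂ} (hc : Continuous u) (hu : VanishesNear x₀ u) :
    Continuous fun x => ‖u x‖ ^ 2 / ‖x - x₀‖ ^ 2 :=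
  hu.continuous_of_continuousAt (fun x hx => by simp [hx]) fun x hx =>
    ContinuousAt.div (by fun_prop) (by fun_prop) (norm_sub_sq_pos hx).ne'

theorem continuousAt_AB {x₀ x : EuclideanSpace ℝ (Fin 2)} (ν : ℝ) (hx : x ≠ x₀) (i : Fin 2) :
    ContinuousAt (fun x => AB x₀ ν x i) x := by
  unfold AB
  fin_cases i
  · exact ContinuousAt.div (by fun_prop) (by fun_prop) (norm_sub_sq_pos hx).ne'
  · exact ContinuousAt.div (by fun_prop) (by fun_prop) (norm_sub_sq_pos hx).ne'

theorem sum_sq_AB (x₀ x : EuclideanSpace ℝ (Fin 2)) (ν : ℝ) :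
    ∑ i, AB x₀ ν x i ^ 2 = ν ^ 2 / ‖x - x₀‖ ^ 2 := by
  rcases eq_or_ne x x₀ with rfl | hx
  · simp [AB]
  · have h := norm_sub_sq_pos hx
    have h2 : ‖x - x₀‖ ^ 2 = (x 0 - x₀ 0) ^ 2 + (x 1 - x₀ 1) ^ 2 := by
      simp [EuclideanSpace.norm_sq_eq, Fin.sum_univ_two]
    simp only [AB, Fin.sum_univ_two, if_true, one_ne_zero, if_false]
    rw [div_pow, div_pow, ← add_div, div_eq_div_iff (by positivity) h.ne', h2]
    ring

theorem continuous_magGradSq {x₀ : EuclideanSpace ℝ (Fin 2)} (ν : ℝ)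
    {u : EuclideanSpace ℝ (Fin 2) → ℂ} (hc : ContDiff ℝ (⊤ : ℕ∞) u) (hu : VanishesNear x₀ u) :
    Continuous (magGradSq (AB x₀ ν) u) := by
  unfold magGradSq
  refine continuous_finsetSum _ fun i _ => ((Continuous.sub ?_ ?_).norm.pow 2)
  · exact (hc.continuous_fderiv (by simp)).clm_apply continuous_const
  · refine hu.continuous_of_continuousAt (fun x hx => by simp [hx]) fun x hx => ?_
    exact (continuousAt_const.mul hc.continuous.continuousAt).mul
      (Complex.continuous_ofReal.continuousAt.comp (continuousAt_AB ν hx i))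

theorem norm_sub_sq_le {F : Type*} [SeminormedAddCommGroup F] (a b : F) :
    ‖a - b‖ ^ 2 ≤ 2 * ‖a‖ ^ 2 + 2 * ‖b‖ ^ 2 := by
  nlinarith [norm_sub_le a b, norm_nonneg (a - b), sq_nonneg (‖a‖ - ‖b‖)]

theorem sum_norm_sq_mul_AB (x₀ x : EuclideanSpace ℝ (Fin 2)) (ν : ℝ) (w : ℂ) :
    ∑ i, ‖Complex.I * w * (AB x₀ ν x i)‖ ^ 2 = ν ^ 2 * (‖w‖ ^ 2 / ‖x - x₀‖ ^ 2) := by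
  simp_rw [norm_mul, mul_pow, Complex.norm_I, Complex.norm_real, Real.norm_eq_abs, sq_abs]
  rw [← Finset.mul_sum, sum_sq_AB]
  ring

theorem magGradSq_le (x₀ x : EuclideanSpace ℝ (Fin 2)) (ν : ℝ)
    (u : EuclideanSpace ℝ (Fin 2) → ℂ) :
    magGradSq (AB x₀ ν) u x ≤
      2 * ∑ i : Fin 2, ‖fderiv ℝ u x (EuclideanSpace.single i 1)‖ ^ 2 +
        2 * ν ^ 2 * (‖u x‖ ^ 2 / ‖x - x₀‖ ^ 2) := by
  rw [mul_assoc, ← sum_norm_sq_mul_AB, Finset.mul_sum, Finset.mul_sum, ← Finset.sum_add_distrib]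
  exact Finset.sum_le_sum fun i _ => norm_sub_sq_le _ _

theorem gradSq_le (x₀ x : EuclideanSpace ℝ (Fin 2)) (ν : ℝ)
    (u : EuclideanSpace ℝ (Fin 2) → ℂ) :
    ∑ i : Fin 2, ‖fderiv ℝ u x (EuclideanSpace.single i 1)‖ ^ 2 ≤
      2 * magGradSq (AB x₀ ν) u x + 2 * ν ^ 2 * (‖u x‖ ^ 2 / ‖x - x₀‖ ^ 2) := by
  rw [mul_assoc, ← sum_norm_sq_mul_AB, magGradSq, Finset.mul_sum, Finset.mul_sum,
    ← Finset.sum_add_distrib]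
  refine Finset.sum_le_sum fun i _ => ?_
  have := norm_sub_sq_le (fderiv ℝ u x (EuclideanSpace.single i 1) - Complex.I * u x * AB x₀ ν x i)
    (-(Complex.I * u x * AB x₀ ν x i))
  rwa [sub_neg_eq_add, sub_add_cancel, norm_neg] at this

theorem magGradSq_nonneg (A : EuclideanSpace ℝ (Fin 2) → Fin 2 → ℝ)
    (u : EuclideanSpace ℝ (Fin 2) → ℂ) (x : EuclideanSpace ℝ (Fin 2)) : 0 ≤ magGradSq A u x :=
  Finset.sum_nonneg fun _ _ => sq_nonneg _

theorem integrableOn_of_isBounded {Ω : Set (EuclideanSpace ℝ (Fin 2))}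
    (hb : Bornology.IsBounded Ω) {g : EuclideanSpace ℝ (Fin 2) → ℝ} (hg : Continuous g) :
    IntegrableOn g Ω :=
  (hg.continuousOn.integrableOn_compact hb.isCompact_closure).mono_set subset_closure

/-- The derivative of `u` along the circle of radius `r` about `x₀`. -/
theorem hasDerivAt_comp_polarMap {u : EuclideanSpace ℝ (Fin 2) → ℂ} (hu : Differentiable ℝ u)
    (x₀ : EuclideanSpace ℝ (Fin 2)) (r θ : ℝ) :
    HasDerivAt (fun θ => u (polarMap x₀ (r, θ)))
      ((-(r * Real.sin θ) : ℝ) * fderiv ℝ u (polarMap x₀ (r, θ)) (EuclideanSpace.single 0 1) +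
        (r * Real.cos θ : ℝ) * fderiv ℝ u (polarMap x₀ (r, θ)) (EuclideanSpace.single 1 1)) θ := by
  have h1 : HasDerivAt (fun θ => polarMap x₀ (r, θ))
      ((-(r * Real.sin θ)) • EuclideanSpace.single 0 1 +
        (r * Real.cos θ) • EuclideanSpace.single 1 1) θ := by
    have hc : (fun θ => polarMap x₀ (r, θ)) = fun θ => x₀ +
        ((r * Real.cos θ) • EuclideanSpace.single (0 : Fin 2) (1 : ℝ) +
          (r * Real.sin θ) • EuclideanSpace.single 1 1) := by
      funext t
      rw [polarMap]
      congr 1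
      ext i
      fin_cases i <;> simp
    rw [hc]
    have hcos := ((Real.hasDerivAt_cos θ).const_mul r).smul_const
      (EuclideanSpace.single (0 : Fin 2) (1 : ℝ))
    have hsin := ((Real.hasDerivAt_sin θ).const_mul r).smul_const
      (EuclideanSpace.single (1 : Fin 2) (1 : ℝ))
    rw [mul_neg] at hcos
    exact (hcos.add hsin).const_add x₀
  have h2 := (hu (polarMap x₀ (r, θ))).hasFDerivAt.comp_hasDerivAt θ h1
  rw [map_add, map_smul, map_smul, Complex.real_smul, Complex.real_smul] at h2
  exact h2

theorem norm_add_mul_sq_le {s c : ℝ} (hsc : s ^ 2 + c ^ 2 = 1) (a b : ℂ) :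
    ‖-(s : ℂ) * a + c * b‖ ^ 2 ≤ ‖a‖ ^ 2 + ‖b‖ ^ 2 := by
  have h := norm_add_le (-(s : ℂ) * a) (c * b)
  simp only [norm_mul, norm_neg, Complex.norm_real, Real.norm_eq_abs] at h
  have h2 : (|s| * ‖a‖ + |c| * ‖b‖) ^ 2 + (|c| * ‖a‖ - |s| * ‖b‖) ^ 2 =
      ‖a‖ ^ 2 + ‖b‖ ^ 2 := by
    have : |s| ^ 2 + |c| ^ 2 = 1 := by rwa [sq_abs, sq_abs]
    linear_combination (‖a‖ ^ 2 + ‖b‖ ^ 2) * this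
  nlinarith [pow_le_pow_left₀ (norm_nonneg _) h 2, sq_nonneg (|c| * ‖a‖ - |s| * ‖b‖)]

/-- The tangential part of the magnetic gradient on a circle about the pole. -/
theorem norm_tangential_sq_le (x₀ : EuclideanSpace ℝ (Fin 2)) (ν : ℝ)
    (u : EuclideanSpace ℝ (Fin 2) → ℂ) {r : ℝ} (hr : 0 < r) (θ : ℝ) :
    ‖((-(r * Real.sin θ) : ℝ) * fderiv ℝ u (polarMap x₀ (r, θ)) (EuclideanSpace.single 0 1) +
        (r * Real.cos θ : ℝ) * fderiv ℝ u (polarMap x₀ (r, θ)) (EuclideanSpace.single 1 1)) -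
          Complex.I * ν * u (polarMap x₀ (r, θ))‖ ^ 2 ≤
      r ^ 2 * magGradSq (AB x₀ ν) u (polarMap x₀ (r, θ)) := by
  have hA0 : AB x₀ ν (polarMap x₀ (r, θ)) 0 = -ν * Real.sin θ / r := by
    simp only [AB, if_true, norm_polarMap_sub, sq_abs]
    simp only [polarMap, PiLp.add_apply, Matrix.cons_val_one,
      Matrix.cons_val_fin_one]
    field_simp
    ring
  have hA1 : AB x₀ ν (polarMap x₀ (r, θ)) 1 = ν * Real.cos θ / r := by
    simp only [AB, one_ne_zero, if_false, norm_polarMap_sub, sq_abs]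
    simp only [polarMap, PiLp.add_apply, Matrix.cons_val_zero]
    field_simp
    ring
  rw [magGradSq, Fin.sum_univ_two, hA0, hA1]
  generalize u (polarMap x₀ (r, θ)) = w
  generalize fderiv ℝ u (polarMap x₀ (r, θ)) (EuclideanSpace.single 0 1) = a
  generalize fderiv ℝ u (polarMap x₀ (r, θ)) (EuclideanSpace.single 1 1) = b
  have hsc : (Real.sin θ : ℂ) ^ 2 + (Real.cos θ : ℂ) ^ 2 = 1 := by
    exact_mod_cast Real.sin_sq_add_cos_sq θ
  have hr' : (r : ℂ) ≠ 0 := by exact_mod_cast hr.ne'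
  have key : ((-(r * Real.sin θ) : ℝ) * a + (r * Real.cos θ : ℝ) * b) - Complex.I * ν * w =
      r * (-(Real.sin θ : ℂ) * (a - Complex.I * w * ((-ν * Real.sin θ / r : ℝ) : ℂ)) +
        (Real.cos θ : ℂ) * (b - Complex.I * w * ((ν * Real.cos θ / r : ℝ) : ℂ))) := by
    push_cast
    push_cast at hsc
    field_simp
    linear_combination (Complex.I * ν * w) * hsc
  rw [key, norm_mul, mul_pow, Complex.norm_real, Real.norm_eq_abs, sq_abs]
  gcongr
  exact norm_add_mul_sq_le (Real.sin_sq_add_cos_sq θ) _ _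

/-- The magnetic Hardy inequality, with a non-optimal constant. -/
theorem setIntegral_hardyWeight_le {ν : ℝ} (hν : ∀ k : ℤ, (k : ℝ) ≠ ν)
    {x₀ : EuclideanSpace ℝ (Fin 2)} {u : EuclideanSpace ℝ (Fin 2) → ℂ}
    (hc : ContDiff ℝ (⊤ : ℕ∞) u) (hu : VanishesNear x₀ u) (R : ℝ) :
    ∫ x in Metric.ball x₀ R, ‖u x‖ ^ 2 / ‖x - x₀‖ ^ 2 ≤
      (2 * Real.pi * (1 + (2 * |Real.sin (ν * Real.pi)|)⁻¹)) ^ 2 *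
        ∫ x in Metric.ball x₀ R, magGradSq (AB x₀ ν) u x := by
  set K := (2 * Real.pi * (1 + (2 * |Real.sin (ν * Real.pi)|)⁻¹)) ^ 2
  have hK0 : 0 ≤ K := sq_nonneg _
  have hM := continuous_magGradSq ν hc hu
  have hW := continuous_hardyWeight hc.continuous hu
  have hb : Bornology.IsBounded (Metric.ball x₀ R) := Metric.isBounded_ball
  rw [← sub_nonneg, ← integral_const_mul,
    ← integral_sub (integrableOn_of_isBounded hb (by fun_prop)) (integrableOn_of_isBounded hb hW)]
  refine setIntegral_ball_nonneg_of_circle ((hM.const_mul K).sub hW) fun r hr => ?_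
  have hγ : Continuous fun θ : ℝ => polarMap x₀ (r, θ) :=
    (continuous_polarMap x₀).comp (by fun_prop)
  have hMγ : Continuous fun θ => magGradSq (AB x₀ ν) u (polarMap x₀ (r, θ)) := hM.comp hγ
  have hder : Continuous (fderiv ℝ u) := hc.continuous_fderiv (by simp)
  have hucγ : Continuous fun θ => u (polarMap x₀ (r, θ)) := hc.continuous.comp hγ
  have hderγ : Continuous fun θ => fderiv ℝ u (polarMap x₀ (r, θ)) := hder.comp hγ
  have hp := integral_norm_sq_le_of_periodic hν
    (fun θ => hasDerivAt_comp_polarMap (hc.differentiable (by simp)) x₀ r θ) (by fun_prop)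
    (by simp [polarMap])
  simp only [norm_polarMap_sub, sq_abs]
  rw [intervalIntegral.integral_sub ((hMγ.const_mul K).intervalIntegrable _ _)
      (Continuous.intervalIntegrable (by fun_prop) _ _), sub_nonneg,
    intervalIntegral.integral_const_mul, intervalIntegral.integral_div,
    div_le_iff₀ (by positivity)]
  refine hp.trans ?_
  rw [mul_assoc K]
  refine mul_le_mul_of_nonneg_left ?_ hK0
  rw [mul_comm _ (r ^ 2), ← intervalIntegral.integral_const_mul]
  exact intervalIntegral.integral_mono_on (by linarith [Real.pi_pos])
    (Continuous.intervalIntegrable (by fun_prop) _ _)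
    ((hMγ.const_mul _).intervalIntegrable _ _)
    fun θ _ => norm_tangential_sq_le x₀ ν u hr θ

theorem exists_setIntegral_hardyWeight_le {Ω : Set (EuclideanSpace ℝ (Fin 2))}
    (hopen : IsOpen Ω) (hbdd : Bornology.IsBounded Ω) {x₀ : EuclideanSpace ℝ (Fin 2)}
    (hx₀ : x₀ ∈ Ω) {ν : ℝ} (hν : ∀ k : ℤ, (k : ℝ) ≠ ν) :
    ∃ K ≥ 0, ∀ u : EuclideanSpace ℝ (Fin 2) → ℂ, ContDiff ℝ (⊤ : ℕ∞) u → VanishesNear x₀ u →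
      ∫ x in Ω, ‖u x‖ ^ 2 / ‖x - x₀‖ ^ 2 ≤
        K * ((∫ x in Ω, magGradSq (AB x₀ ν) u x) + ∫ x in Ω, ‖u x‖ ^ 2) := by
  obtain ⟨R, hR, hball⟩ := Metric.isOpen_iff.1 hopen x₀ hx₀
  set K := (2 * Real.pi * (1 + (2 * |Real.sin (ν * Real.pi)|)⁻¹)) ^ 2
  have hK0 : 0 ≤ K := sq_nonneg _
  refine ⟨K + (R ^ 2)⁻¹, by positivity, fun u hc hu => ?_⟩
  have hM := integrableOn_of_isBounded hbdd (continuous_magGradSq ν hc hu)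
  have hW := integrableOn_of_isBounded hbdd (continuous_hardyWeight hc.continuous hu)
  have hN : IntegrableOn (fun x => ‖u x‖ ^ 2) Ω :=
    integrableOn_of_isBounded hbdd (hc.continuous.norm.pow 2)
  have hmeas : MeasurableSet (Metric.ball x₀ R) := Metric.isOpen_ball.measurableSet
  have hin : ∫ x in Metric.ball x₀ R, ‖u x‖ ^ 2 / ‖x - x₀‖ ^ 2 ≤
      K * ∫ x in Ω, magGradSq (AB x₀ ν) u x :=
    (setIntegral_hardyWeight_le hν hc hu R).trans <| mul_le_mul_of_nonneg_left
      (setIntegral_mono_set hM (Filter.Eventually.of_forall fun x => magGradSq_nonneg _ _ _)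
        hball.eventuallyLE) hK0
  have hout : ∫ x in Ω \ Metric.ball x₀ R, ‖u x‖ ^ 2 / ‖x - x₀‖ ^ 2 ≤
      (R ^ 2)⁻¹ * ∫ x in Ω, ‖u x‖ ^ 2 := by
    rw [← integral_const_mul]
    refine (setIntegral_mono_on (hW.mono_set Set.sdiff_subset)
      ((hN.mono_set Set.sdiff_subset).const_mul (R ^ 2)⁻¹)
      (hopen.measurableSet.diff hmeas) fun x hx => ?_).trans
      (setIntegral_mono_set (hN.const_mul _)
        (Filter.Eventually.of_forall fun x => by simp only [Pi.zero_apply]; positivity)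
        Set.sdiff_subset.eventuallyLE)
    have hxR : R ≤ ‖x - x₀‖ := not_lt.1 (mem_ball_iff_norm.not.1 hx.2)
    rw [div_eq_inv_mul]
    gcongr
  have hsplit := setIntegral_sdiff hmeas hW hball
  have hM0 : 0 ≤ ∫ x in Ω, magGradSq (AB x₀ ν) u x :=
    integral_nonneg fun x => magGradSq_nonneg _ _ _
  have hN0 : 0 ≤ ∫ x in Ω, ‖u x‖ ^ 2 := integral_nonneg fun x => sq_nonneg _
  have hR0 : 0 ≤ (R ^ 2)⁻¹ := by positivity
  nlinarith [mul_nonneg hK0 hN0, mul_nonneg hR0 hM0]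

/-- Equivalence of the magnetic Sobolev norm and the weighted Sobolev norm with
inverse-square weight, for non-integer flux ν. -/
theorem magnetic_norm_equivalence (Ω : Set (EuclideanSpace ℝ (Fin 2)))
    (hopen : IsOpen Ω) (hbdd : Bornology.IsBounded Ω) (hsmooth : HasSmoothBoundary Ω)
    (x₀ : EuclideanSpace ℝ (Fin 2)) (hx₀ : x₀ ∈ Ω)
    (ν : ℝ) (hν : ∀ k : ℤ, (k : ℝ) ≠ ν) :
    ∃ c > 0, ∃ C > 0, ∀ u : EuclideanSpace ℝ (Fin 2) → ℂ,
      ContDiff ℝ (⊤ : ℕ∞) u → VanishesNear x₀ u →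
      (c * ∫ x in Ω, (∑ i : Fin 2, ‖fderiv ℝ u x (EuclideanSpace.single i 1)‖ ^ 2) +
            ‖u x‖ ^ 2 + ‖u x‖ ^ 2 / ‖x - x₀‖ ^ 2) ≤
          (∫ x in Ω, magGradSq (AB x₀ ν) u x + ‖u x‖ ^ 2) ∧
        (∫ x in Ω, magGradSq (AB x₀ ν) u x + ‖u x‖ ^ 2) ≤
          C * ∫ x in Ω, (∑ i : Fin 2, ‖fderiv ℝ u x (EuclideanSpace.single i 1)‖ ^ 2) +
            ‖u x‖ ^ 2 + ‖u x‖ ^ 2 / ‖x - x₀‖ ^ 2 := by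
  obtain ⟨K, hK, hardy⟩ := exists_setIntegral_hardyWeight_le hopen hbdd hx₀ hν
  refine ⟨(2 + (2 * ν ^ 2 + 1) * K)⁻¹, by positivity, 2 + 2 * ν ^ 2, by positivity,
    fun u hc hu => ?_⟩
  have hder : Continuous (fderiv ℝ u) := hc.continuous_fderiv (by simp)
  have hD := integrableOn_of_isBounded hbdd (g := fun x =>
    ∑ i : Fin 2, ‖fderiv ℝ u x (EuclideanSpace.single i 1)‖ ^ 2) (by fun_prop)
  have hM := integrableOn_of_isBounded hbdd (continuous_magGradSq ν hc hu)
  have hW := integrableOn_of_isBounded hbdd (continuous_hardyWeight hc.continuous hu)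
  have hN : IntegrableOn (fun x => ‖u x‖ ^ 2) Ω :=
    integrableOn_of_isBounded hbdd (hc.continuous.norm.pow 2)
  have hDle := integral_mono hD ((hM.const_mul 2).add (hW.const_mul (2 * ν ^ 2)))
    fun x => gradSq_le x₀ x ν u
  have hMle := integral_mono hM ((hD.const_mul 2).add (hW.const_mul (2 * ν ^ 2)))
    fun x => magGradSq_le x₀ x ν u
  have hWle := hardy u hc hu
  have hD0 : 0 ≤ ∫ x in Ω, ∑ i : Fin 2, ‖fderiv ℝ u x (EuclideanSpace.single i 1)‖ ^ 2 :=
    integral_nonneg fun x => Finset.sum_nonneg fun _ _ => sq_nonneg _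
  have hW0 : 0 ≤ ∫ x in Ω, ‖u x‖ ^ 2 / ‖x - x₀‖ ^ 2 := integral_nonneg fun x => by
    simp only [Pi.zero_apply]; positivity
  have hN0 : 0 ≤ ∫ x in Ω, ‖u x‖ ^ 2 := integral_nonneg fun x => sq_nonneg _
  simp only [Pi.add_apply] at hDle hMle
  rw [integral_add (hM.const_mul 2) (hW.const_mul (2 * ν ^ 2)), integral_const_mul,
    integral_const_mul] at hDle
  rw [integral_add (hD.const_mul 2) (hW.const_mul (2 * ν ^ 2)), integral_const_mul,
    integral_const_mul] at hMle
  have hsum : ∫ x in Ω, (∑ i : Fin 2, ‖fderiv ℝ u x (EuclideanSpace.single i 1)‖ ^ 2) +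
      ‖u x‖ ^ 2 + ‖u x‖ ^ 2 / ‖x - x₀‖ ^ 2 =
      (∫ x in Ω, ∑ i : Fin 2, ‖fderiv ℝ u x (EuclideanSpace.single i 1)‖ ^ 2) +
        (∫ x in Ω, ‖u x‖ ^ 2) + ∫ x in Ω, ‖u x‖ ^ 2 / ‖x - x₀‖ ^ 2 := by
    rw [← integral_add hD hN]
    exact integral_add (hD.add hN) hW
  rw [hsum, integral_add hM hN]
  constructor
  · rw [inv_mul_le_iff₀ (by positivity)]
    linarith [mul_le_mul_of_nonneg_left hWle (by positivity : 0 ≤ 2 * ν ^ 2 + 1)]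
  · have hν0 := sq_nonneg ν
    linarith [mul_nonneg hν0 hD0, mul_nonneg hν0 hN0]
end

section
/- Let T > 0 and let a : (0,T] → ℝ be differentiable with 0 < a(r) < 4π and a'(r) ≥ a(r)(4π − a(r))/(2πr) for all r ∈ (0,T]. Then the function r ↦ a(r)/(r²(4π − a(r))) is monotone nondecreasing on (0,T]. In particular, if a(T) = 4πT²/(1+T²), then a(r) ≤ 4πr²/(1+r²) for all r ∈ (0,T]. -/
open Set

theorem hasDerivAt_div_sq_mul_sub {a : ℝ → ℝ} {a' c r : ℝ} (ha : HasDerivAt a a' r)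
    (hr : r ≠ 0) (hc : c - a r ≠ 0) :
    HasDerivAt (fun x => a x / (x ^ 2 * (c - a x)))
      ((c * r ^ 2 * a' - 2 * r * (a r * (c - a r))) / (r ^ 2 * (c - a r)) ^ 2) r := by
  have hden : HasDerivAt (fun x => x ^ 2 * (c - a x))
      (2 * r * (c - a r) + r ^ 2 * (-a')) r := by
    simpa using (hasDerivAt_pow 2 r).fun_mul (ha.const_sub c)
  refine (ha.fun_div hden (mul_ne_zero (pow_ne_zero 2 hr) hc)).congr_deriv ?_
  ring

theorem monotoneOn_div_sq_mul_sub {s : Set ℝ} (hs : Convex ℝ s) {a : ℝ → ℝ} {c : ℝ}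
    (hspos : ∀ r ∈ s, 0 < r) (had : ∀ r ∈ s, DifferentiableAt ℝ a r)
    (hlt : ∀ r ∈ s, a r < c)
    (hineq : ∀ r ∈ s, 2 * (a r * (c - a r)) ≤ c * r * deriv a r) :
    MonotoneOn (fun r => a r / (r ^ 2 * (c - a r))) s := by
  have hd := fun r (hr : r ∈ s) => hasDerivAt_div_sq_mul_sub (had r hr).hasDerivAt
    (hspos r hr).ne' (sub_pos.2 (hlt r hr)).ne'
  refine monotoneOn_of_deriv_nonneg hs
    (fun r hr => (hd r hr).continuousAt.continuousWithinAt)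
    (fun r hr => (hd r (interior_subset hr)).differentiableAt.differentiableWithinAt)
    fun r hr => ?_
  have hr' := interior_subset hr
  rw [(hd r hr').deriv]
  refine div_nonneg ?_ (sq_nonneg _)
  linarith [mul_le_mul_of_nonneg_left (hineq r hr') (hspos r hr').le]

/-- The differential comparison underlying Szegő's conformal transplantation argument on
the sphere: if a satisfies a'(r) ≥ a(4π − a)/(2πr), then a/(r²(4π − a)) is nondecreasing,
and the normalization a(T) = 4πT²/(1+T²) forces a(r) ≤ 4πr²/(1+r²). -/
theorem szego_area_comparison (T : ℝ) (hT : 0 < T) (a : ℝ → ℝ)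
    (had : ∀ r ∈ Ioc 0 T, DifferentiableAt ℝ a r)
    (hapos : ∀ r ∈ Ioc 0 T, 0 < a r)
    (halt : ∀ r ∈ Ioc 0 T, a r < 4 * Real.pi)
    (hineq : ∀ r ∈ Ioc 0 T,
      a r * (4 * Real.pi - a r) / (2 * Real.pi * r) ≤ deriv a r) :
    MonotoneOn (fun r => a r / (r ^ 2 * (4 * Real.pi - a r))) (Ioc 0 T) ∧
    (a T = 4 * Real.pi * T ^ 2 / (1 + T ^ 2) →
      ∀ r ∈ Ioc 0 T, a r ≤ 4 * Real.pi * r ^ 2 / (1 + r ^ 2)) := by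
  have hmono : MonotoneOn (fun r => a r / (r ^ 2 * (4 * Real.pi - a r))) (Ioc 0 T) := by
    refine monotoneOn_div_sq_mul_sub (convex_Ioc 0 T) (fun r hr => hr.1) had halt fun r hr => ?_
    have h := (div_le_iff₀ (mul_pos Real.two_pi_pos hr.1)).1 (hineq r hr)
    linarith
  refine ⟨hmono, fun haT r hr => ?_⟩
  have hpos : 0 < 4 * Real.pi - a r := sub_pos.2 (halt r hr)
  have hval : a T / (T ^ 2 * (4 * Real.pi - a T)) = 1 := by
    have hsub : 0 < 4 * Real.pi - a T := sub_pos.2 (halt T ⟨hT, le_rfl⟩)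
    rw [div_eq_one_iff_eq (by positivity)]
    rw [eq_div_iff (by positivity)] at haT
    linarith
  have h : a r / (r ^ 2 * (4 * Real.pi - a r)) ≤ 1 :=
    (hmono hr ⟨hT, le_rfl⟩ hr.2).trans_eq hval
  rw [div_le_one (mul_pos (pow_pos hr.1 2) hpos)] at h
  rw [le_div_iff₀ (by positivity)]
  linarith
end
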